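/- arXiv:2107.05690 — 3 statements merged into one kernel-verified Lean document; each statement's English description precedes it below -/
import Mathlib

section
/- For every tollbooth instance on a spider graph, there exists an item pricing p such that for every arrival order σ there is a tie-breaking choice t with Wel(p,σ,t) ≥ (2/3)·OPT. (The competitive ratio of item pricing with seller tie-breaking power on spiders is at most 3/2.) -/
open scoped Classical NNReal ENNReal

noncomputable section

namespace Tollbooth

variable {V : Type*} [Fintype V] [DecidableEq V]

/-- Total price (in `ℝ≥0∞`) of a set of edges under an item pricing `p`. -/
def price (p : Sym2 V → ℝ≥0∞) (s : Finset (Sym2 V)) : ℝ≥0∞ := ∑ e ∈ s, p e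

/-- One step of the selling process: the state consists of the set of available edges together
with the set of buyers that have purchased so far; buyer `j` purchases exactly when all the
edges of her demand path are available and either the price is strictly below her value, or the
price equals her value and her tie-breaking bit `t j` is `true`. -/
def step {n : ℕ} (p : Sym2 V → ℝ≥0∞) (Q : Fin n → Finset (Sym2 V)) (v : Fin n → ℝ≥0)
    (t : Fin n → Bool) (st : Finset (Sym2 V) × Finset (Fin n)) (j : Fin n) :
    Finset (Sym2 V) × Finset (Fin n) :=
  if Q j ⊆ st.1 ∧
      (price p (Q j) < (v j : ℝ≥0∞) ∨ (price p (Q j) = (v j : ℝ≥0∞) ∧ t j = true)) then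
    (st.1 \ Q j, insert j st.2)
  else st

/-- The set of buyers who purchase, when buyers arrive in the order `σ 0, σ 1, …`,
starting from all edges of `G` being available. -/
def purchased {n : ℕ} (G : SimpleGraph V) (p : Sym2 V → ℝ≥0∞) (Q : Fin n → Finset (Sym2 V))
    (v : Fin n → ℝ≥0) (σ : Equiv.Perm (Fin n)) (t : Fin n → Bool) : Finset (Fin n) :=
  ((List.ofFn fun i => σ i).foldl (step p Q v t) (G.edgeFinset, ∅)).2

/-- The welfare obtained by the item pricing `p` under arrival order `σ` and
tie-breaking choice `t`. -/
def Wel {n : ℕ} (G : SimpleGraph V) (p : Sym2 V → ℝ≥0∞) (Q : Fin n → Finset (Sym2 V))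
    (v : Fin n → ℝ≥0) (σ : Equiv.Perm (Fin n)) (t : Fin n → Bool) : ℝ≥0 :=
  ∑ j ∈ purchased G p Q v σ t, v j

/-- The hindsight optimal welfare: the maximum total value of a set of buyers whose demand
paths are pairwise edge-disjoint. -/
def OPT {n : ℕ} (Q : Fin n → Finset (Sym2 V)) (v : Fin n → ℝ≥0) : ℝ≥0 :=
  (Finset.univ.powerset.filter fun S : Finset (Fin n) =>
      (S : Set (Fin n)).Pairwise fun j k => Disjoint (Q j) (Q k)).sup
    fun S => ∑ j ∈ S, v j

/-- `s` is the (nonempty) edge set of a path of `G`. -/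
def IsPathEdges (G : SimpleGraph V) (s : Finset (Sym2 V)) : Prop :=
  ∃ (a b : V) (W : G.Walk a b), W.IsPath ∧ W.edges ≠ [] ∧ s = W.edges.toFinset

/-- A tollbooth instance on `G`: at least one buyer, every buyer has positive value and
demands (the edge set of) a path of `G`. -/
def Instance {n : ℕ} (G : SimpleGraph V) (Q : Fin n → Finset (Sym2 V)) (v : Fin n → ℝ≥0) :
    Prop :=
  1 ≤ n ∧ ∀ j, 0 < v j ∧ IsPathEdges G (Q j)

/-- A star: a tree all of whose edges share a common vertex. -/
def IsStar (G : SimpleGraph V) : Prop := G.IsTree ∧ ∃ c : V, ∀ e ∈ G.edgeSet, c ∈ e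

/-- A spider: a tree with at most one vertex of degree at least `3`. -/
def IsSpider (G : SimpleGraph V) : Prop :=
  G.IsTree ∧ {w : V | 3 ≤ G.degree w}.Subsingleton

/-- A cycle graph: a connected graph in which every vertex has degree exactly `2`. -/
def IsCycleGraph (G : SimpleGraph V) : Prop := G.Connected ∧ ∀ w : V, G.degree w = 2

/-- A path graph: a tree in which every vertex has degree at most `2`. -/
def IsPathGraph (G : SimpleGraph V) : Prop := G.IsTree ∧ ∀ w : V, G.degree w ≤ 2

end Tollbooth

namespace Tollbooth

section Sale

variable {V : Type*} [DecidableEq V] {n : ℕ}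

theorem subset_foldl_step (p : Sym2 V → ℝ≥0∞) (Q : Fin n → Finset (Sym2 V)) (v : Fin n → ℝ≥0)
    (S : Finset (Fin n)) (hS : (S : Set (Fin n)).Pairwise fun j k => Disjoint (Q j) (Q k))
    (hp : ∀ j, (v j : ℝ≥0∞) ≤ price p (Q j)) (ht : ∀ j ∈ S, price p (Q j) = v j)
    (l : List (Fin n)) (hl : l.Nodup) (st : Finset (Sym2 V) × Finset (Fin n))
    (hst : ∀ j ∈ S, j ∈ l → Q j ⊆ st.1) :
    st.2 ⊆ (l.foldl (step p Q v fun j => decide (j ∈ S)) st).2 ∧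
      ∀ j ∈ S, j ∈ l → j ∈ (l.foldl (step p Q v fun j => decide (j ∈ S)) st).2 := by
  induction l generalizing st with
  | nil => simp
  | cons a l ih =>
    rw [List.nodup_cons] at hl
    simp only [List.foldl_cons]
    by_cases ha : a ∈ S
    · have hstep : step p Q v (fun j => decide (j ∈ S)) st a
          = (st.1 \ Q a, insert a st.2) := by
        rw [step, if_pos]
        exact ⟨hst a ha List.mem_cons_self, Or.inr ⟨ht a ha, by simpa using ha⟩⟩
      rw [hstep]
      obtain ⟨h1, h2⟩ := ih hl.2 (st.1 \ Q a, insert a st.2) (by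
        intro j hj hjl
        have hne : j ≠ a := by rintro rfl; exact hl.1 hjl
        exact Finset.subset_sdiff.2 ⟨hst j hj (List.mem_cons_of_mem _ hjl), hS hj ha hne⟩)
      refine ⟨(Finset.subset_insert _ _).trans h1, fun j hj hjl => ?_⟩
      rcases List.mem_cons.1 hjl with rfl | hjl
      · exact h1 (Finset.mem_insert_self _ _)
      · exact h2 j hj hjl
    · have hstep : step p Q v (fun j => decide (j ∈ S)) st a = st := by
        rw [step, if_neg]
        rintro ⟨-, h | h⟩
        · exact absurd h (not_lt.2 (hp a))
        · exact ha (by simpa using h.2)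
      rw [hstep]
      obtain ⟨h1, h2⟩ := ih hl.2 st fun j hj hjl => hst j hj (List.mem_cons_of_mem _ hjl)
      refine ⟨h1, fun j hj hjl => ?_⟩
      rcases List.mem_cons.1 hjl with rfl | hjl
      · exact absurd hj ha
      · exact h2 j hj hjl

/-- If no buyer values her path above its price, then the seller can serve any set of
edge-disjoint buyers whose paths are priced exactly at their values, in every arrival order. -/
theorem sum_le_Wel [Fintype V] (G : SimpleGraph V) (p : Sym2 V → ℝ≥0∞) (Q : Fin n → Finset (Sym2 V))
    (v : Fin n → ℝ≥0) (S : Finset (Fin n))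
    (hS : (S : Set (Fin n)).Pairwise fun j k => Disjoint (Q j) (Q k))
    (hQ : ∀ j, Q j ⊆ G.edgeFinset)
    (hp : ∀ j, (v j : ℝ≥0∞) ≤ price p (Q j)) (ht : ∀ j ∈ S, price p (Q j) = v j)
    (σ : Equiv.Perm (Fin n)) :
    ∑ j ∈ S, v j ≤ Wel G p Q v σ fun j => decide (j ∈ S) := by
  refine Finset.sum_le_sum_of_subset fun j hj => ?_
  refine (subset_foldl_step p Q v S hS hp ht _ (List.nodup_ofFn.2 σ.injective) _
    fun j _ _ => hQ j).2 j hj ?_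
  simp only [List.mem_ofFn]
  exact ⟨σ.symm j, by simp⟩

end Sale

/-- Egerváry-type duality for a symmetric weight function, with a symmetric dual solution. -/
theorem exists_symmetric_cover {ι : Type*} [Fintype ι] (w : ι → ι → ℝ)
    (hsymm : ∀ i j, w i j = w j i) (hw : ∀ i j, 0 ≤ w i j) :
    ∃ r : ι → ℝ, (∀ i j, w i j ≤ r i + r j) ∧
      ∃ π : Equiv.Perm ι, ∀ i, r i + r (π i) = w i (π i) := by
  set c : ℝ := ∑ i, ∑ j, w i j with hc
  have hc0 : 0 ≤ c := Finset.sum_nonneg fun i _ => Finset.sum_nonneg fun j _ => hw i j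
  have hwc : ∀ i j, w i j ≤ c := fun i j =>
    (Finset.single_le_sum (f := fun j => w i j) (fun j _ => hw i j) (Finset.mem_univ j)).trans
      (Finset.single_le_sum (f := fun i => ∑ j, w i j)
        (fun i _ => Finset.sum_nonneg fun j _ => hw i j) (Finset.mem_univ i))
  set C : ℝ := ∑ _i : ι, c with hC
  set K : Set (ι → ℝ) :=
    {r | ∀ i j, w i j ≤ r i + r j} ∩ Set.Icc 0 (fun _ => C) with hK
  have hcomp : IsCompact K := by
    refine isCompact_Icc.inter_left ?_
    have : {r : ι → ℝ | ∀ i j, w i j ≤ r i + r j} = ⋂ i, ⋂ j, {r | w i j ≤ r i + r j} := by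
      ext; simp
    rw [this]
    exact isClosed_iInter fun i => isClosed_iInter fun j =>
      isClosed_le continuous_const ((continuous_apply i).add (continuous_apply j))
  have hr0 : (fun _ => c) ∈ K :=
    ⟨fun i j => by have := hwc i j; simp only; linarith, fun i => hc0, fun i =>
      Finset.single_le_sum (f := fun _ => c) (fun _ _ => hc0) (Finset.mem_univ i)⟩
  obtain ⟨r, hrK, hmin⟩ := hcomp.exists_isMinOn ⟨_, hr0⟩
    (f := fun r => ∑ i, r i) (by fun_prop)
  have hrC : ∑ i, r i ≤ C := hmin hr0
  refine ⟨r, hrK.1, ?_⟩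
  have hall := (Fintype.all_card_le_filter_rel_iff_exists_injective
    fun i j => r i + r j = w i j).1 ?_
  · obtain ⟨f, hf, hr⟩ := hall
    exact ⟨Equiv.ofBijective f (Finite.injective_iff_bijective.1 hf), hr⟩
  intro A
  by_contra! hlt
  set N : Finset ι := Finset.univ.filter fun j => ∃ i ∈ A, r i + r j = w i j with hN
  obtain ⟨ε, hε, hε0⟩ : ∃ ε : ℝ, (∀ i j, w i j < r i + r j → w i j + 2 * ε ≤ r i + r j) ∧
      0 < ε := by
    have h : ∀ᶠ ε : ℝ in nhdsWithin 0 (Set.Ioi 0),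
        ∀ i j, w i j < r i + r j → w i j + 2 * ε ≤ r i + r j := by
      rw [Filter.eventually_all]; intro i
      rw [Filter.eventually_all]; intro j
      by_cases h : w i j < r i + r j
      · have : ∀ᶠ ε : ℝ in nhds 0, w i j + 2 * ε < r i + r j := by
          apply ContinuousAt.eventually_lt (by fun_prop) (by fun_prop)
          simpa using h
        filter_upwards [nhdsWithin_le_nhds this] with ε hε _ using hε.le
      · simp [h]
    exact (h.and self_mem_nhdsWithin).exists
  set r' : ι → ℝ := fun i => r i + ((if i ∈ N then ε else 0) - if i ∈ A then ε else 0) with hr'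
  have hfeas : ∀ i j, w i j ≤ r' i + r' j := by
    intro i j
    have h0 := hrK.1 i j
    by_cases htight : r i + r j = w i j
    · have h1 : i ∈ A → j ∈ N := fun hi => by
        rw [hN, Finset.mem_filter]; exact ⟨Finset.mem_univ _, i, hi, htight⟩
      have h2 : j ∈ A → i ∈ N := fun hj => by
        rw [hN, Finset.mem_filter]
        exact ⟨Finset.mem_univ _, j, hj, by rw [hsymm, ← htight]; ring⟩
      have h3 : (if i ∈ A then ε else 0) ≤ if j ∈ N then ε else 0 := by
        by_cases hi : i ∈ A
        · rw [if_pos hi, if_pos (h1 hi)]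
        · rw [if_neg hi]; split_ifs <;> linarith
      have h4 : (if j ∈ A then ε else 0) ≤ if i ∈ N then ε else 0 := by
        by_cases hj : j ∈ A
        · rw [if_pos hj, if_pos (h2 hj)]
        · rw [if_neg hj]; split_ifs <;> linarith
      simp only [hr']
      linarith
    · have := hε i j (lt_of_le_of_ne h0 (Ne.symm htight))
      simp only [hr']
      split_ifs <;> linarith
  have hr'0 : ∀ i, 0 ≤ r' i := fun i => by have := hfeas i i; have := hw i i; linarith
  have hsum : ∑ i, r' i < ∑ i, r i := by
    simp only [hr', Finset.sum_add_distrib, Finset.sum_sub_distrib, Finset.sum_ite_mem,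
      Finset.univ_inter, Finset.sum_const, nsmul_eq_mul]
    have : (N.card : ℝ) < A.card := by exact_mod_cast hlt
    nlinarith
  have hr'K : r' ∈ K := ⟨hfeas, hr'0, fun i =>
    (Finset.single_le_sum (fun i _ => hr'0 i) (Finset.mem_univ i)).trans (hsum.le.trans hrC)⟩
  exact absurd (hmin hr'K) (not_le.2 hsum)

/-- Greedy colouring: a family of sets covering each point at most twice is 3-colourable as soon
as each member has at most two points through which all conflicts with lower members pass. -/
theorem exists_three_coloring {M E : Type*} (s : Finset M) (R : M → Finset E) (rank : M → ℕ)
    (hload : ∀ e, (s.filter fun m => e ∈ R m).card ≤ 2)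
    (htop : ∀ m ∈ s, ∃ T : Finset E, T ⊆ R m ∧ T.card ≤ 2 ∧
      ∀ m' ∈ s, rank m' ≤ rank m → ¬ Disjoint (R m') (R m) → ¬ Disjoint (R m') T) :
    ∃ col : M → Fin 3, ∀ m ∈ s, ∀ m' ∈ s, m ≠ m' → col m = col m' → Disjoint (R m) (R m') := by
  suffices h : ∀ s' : Finset M, s' ⊆ s → ∃ col : M → Fin 3, ∀ m ∈ s', ∀ m' ∈ s', m ≠ m' →
      col m = col m' → Disjoint (R m) (R m') from h s subset_rfl
  intro s'
  induction s' using Finset.induction_on_max_value rank with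
  | empty => simp
  | insert a s' ha hmax ih =>
    intro hs
    obtain ⟨has, hs's⟩ := Finset.insert_subset_iff.1 hs
    obtain ⟨col, hcol⟩ := ih hs's
    obtain ⟨T, hT, hcard, hconf⟩ := htop a has
    set N : Finset M := T.biUnion fun e => (s.filter fun m => e ∈ R m).erase a with hN
    have hNcard : N.card ≤ 2 := by
      refine (Finset.card_biUnion_le_card_mul T _ 1 fun e he => ?_).trans (by simpa using hcard)
      have h2 := hload e
      rw [Finset.card_erase_of_mem (Finset.mem_filter.2 ⟨has, hT he⟩)]
      omega
    obtain ⟨x, hx⟩ : ∃ x : Fin 3, x ∉ N.image col := by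
      by_contra! h
      have h3 : (Finset.univ : Finset (Fin 3)).card ≤ (N.image col).card :=
        Finset.card_le_card fun x _ => h x
      have h4 := Finset.card_image_le (s := N) (f := col)
      simp at h3
      omega
    have key : ∀ m ∈ s', x = col m → Disjoint (R m) (R a) := by
      intro m hm hxm
      by_contra hdis
      obtain ⟨e, heM, heT⟩ := Finset.not_disjoint_iff.1
        (hconf m (hs's hm) (hmax m hm) hdis)
      refine hx (Finset.mem_image.2 ⟨m, ?_, hxm.symm⟩)
      rw [hN, Finset.mem_biUnion]
      refine ⟨e, heT, Finset.mem_erase.2 ⟨?_, Finset.mem_filter.2 ⟨hs's hm, heM⟩⟩⟩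
      rintro rfl
      exact ha hm
    refine ⟨Function.update col a x, ?_⟩
    intro m hm m' hm' hne hcc
    rcases Finset.mem_insert.1 hm with rfl | hms
    · rcases Finset.mem_insert.1 hm' with rfl | hms'
      · exact absurd rfl hne
      · rw [Function.update_self, Function.update_of_ne (Ne.symm hne)] at hcc
        exact (key m' hms' hcc).symm
    · have hma : m ≠ a := by rintro rfl; exact ha hms
      rcases Finset.mem_insert.1 hm' with rfl | hms'
      · rw [Function.update_self, Function.update_of_ne hma] at hcc
        exact key m hms hcc.symm
      · have hma' : m' ≠ a := by rintro rfl; exact ha hms'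
        rw [Function.update_of_ne hma, Function.update_of_ne hma'] at hcc
        exact hcol m hms m' hms' hne hcc

end Tollbooth

namespace Tollbooth

section Packing

variable {E J : Type*} [Fintype J] (Q : J → Finset E) (v : J → ℝ≥0)

/-- The maximum total value of edge-disjoint buyers all of whose edges lie in `F`. -/
def opt (F : Finset E) : ℝ≥0 :=
  (Finset.univ.filter fun S : Finset J =>
    (∀ j ∈ S, Q j ⊆ F) ∧ (S : Set J).Pairwise fun j k => Disjoint (Q j) (Q k)).sup
    fun S => ∑ j ∈ S, v j

variable {Q v}

theorem sum_le_opt {F : Finset E} {S : Finset J} (hF : ∀ j ∈ S, Q j ⊆ F)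
    (hS : (S : Set J).Pairwise fun j k => Disjoint (Q j) (Q k)) :
    ∑ j ∈ S, v j ≤ opt Q v F :=
  Finset.le_sup (f := fun S => ∑ j ∈ S, v j)
    (Finset.mem_filter.2 ⟨Finset.mem_univ S, hF, hS⟩)

variable (Q v) in
theorem exists_sum_eq_opt (F : Finset E) : ∃ S : Finset J, (∀ j ∈ S, Q j ⊆ F) ∧
    ((S : Set J).Pairwise fun j k => Disjoint (Q j) (Q k)) ∧ ∑ j ∈ S, v j = opt Q v F := by
  obtain ⟨S, hS, h⟩ := Finset.exists_mem_eq_sup (Finset.univ.filter fun S : Finset J =>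
    (∀ j ∈ S, Q j ⊆ F) ∧ (S : Set J).Pairwise fun j k => Disjoint (Q j) (Q k))
    ⟨∅, by simp⟩ fun S => ∑ j ∈ S, v j
  rw [Finset.mem_filter] at hS
  exact ⟨S, hS.2.1, hS.2.2, h.symm⟩

theorem opt_mono {F H : Finset E} (h : F ⊆ H) : (opt Q v F : ℝ) ≤ opt Q v H := by
  obtain ⟨S, h1, h2, h3⟩ := exists_sum_eq_opt Q v F
  rw [← h3]
  exact_mod_cast sum_le_opt (fun j hj => (h1 j hj).trans h) h2

theorem le_opt {F : Finset E} {j : J} (h : Q j ⊆ F) : (v j : ℝ) ≤ opt Q v F := by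
  have := sum_le_opt (Q := Q) (v := v) (F := F) (S := {j}) (by simpa using h) (by simp)
  rw [Finset.sum_singleton] at this
  exact_mod_cast this

theorem opt_add_opt_le (hne : ∀ j, (Q j).Nonempty) {F F' H : Finset E} (hd : Disjoint F F')
    (hF : F ⊆ H) (hF' : F' ⊆ H) : (opt Q v F : ℝ) + opt Q v F' ≤ opt Q v H := by
  obtain ⟨S, h1, h2, h3⟩ := exists_sum_eq_opt Q v F
  obtain ⟨S', h1', h2', h3'⟩ := exists_sum_eq_opt Q v F'
  have hSS' : Disjoint S S' := by
    rw [Finset.disjoint_left]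
    intro j hj hj'
    obtain ⟨e, he⟩ := hne j
    exact Finset.disjoint_left.1 hd (h1 j hj he) (h1' j hj' he)
  rw [← h3, ← h3', ← NNReal.coe_add, ← Finset.sum_union hSS', NNReal.coe_le_coe]
  apply sum_le_opt
  · intro j hj
    rcases Finset.mem_union.1 hj with hj | hj
    · exact (h1 j hj).trans hF
    · exact (h1' j hj).trans hF'
  · intro j hj k hk hjk
    rcases Finset.mem_union.1 hj with hj | hj <;> rcases Finset.mem_union.1 hk with hk | hk
    · exact h2 hj hk hjk
    · exact Finset.disjoint_of_subset_left (h1 j hj)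
        (Finset.disjoint_of_subset_right (h1' k hk) hd)
    · exact Finset.disjoint_of_subset_left (h1' j hj)
        (Finset.disjoint_of_subset_right (h1 k hk) hd.symm)
    · exact h2' hj hk hjk

end Packing

section Legs

variable {E ι : Type*} (U : Finset E) (leg : E → ι) (dep : E → ℕ)

/-- The edges of leg `k` whose depth lies in `(a, b]`. -/
def seg (k : ι) (a b : ℕ) : Finset E := U.filter fun e => leg e = k ∧ a < dep e ∧ dep e ≤ b

/-- The edges of leg `k` at depth more than `a`. -/
def outer (k : ι) (a : ℕ) : Finset E := U.filter fun e => leg e = k ∧ a < dep e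

/-- All edges of leg `k`. -/
def legSet (k : ι) : Finset E := U.filter fun e => leg e = k

variable {U leg dep}

theorem sum_seg (hinj : ∀ e ∈ U, ∀ f ∈ U, leg e = leg f → dep e = dep f → e = f)
    (F : ι → ℕ → ℝ) {k : ι} {a b : ℕ} (hab : a ≤ b)
    (hb : ∀ n, 1 ≤ n → n ≤ b → ∃ e ∈ U, leg e = k ∧ dep e = n) :
    ∑ e ∈ seg U leg dep k a b, (F (leg e) (dep e) - F (leg e) (dep e - 1)) =
      F k b - F k a := by
  induction b, hab using Nat.le_induction with
  | base =>
    have : seg U leg dep k a a = ∅ := by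
      ext e; simp only [seg, Finset.mem_filter, Finset.notMem_empty, iff_false]; omega
    simp [this]
  | succ b hab ih =>
    obtain ⟨e, heU, hek, hed⟩ := hb (b + 1) (by omega) le_rfl
    have he : e ∉ seg U leg dep k a b := by
      simp only [seg, Finset.mem_filter]; omega
    have : seg U leg dep k a (b + 1) = insert e (seg U leg dep k a b) := by
      ext f
      simp only [seg, Finset.mem_filter, Finset.mem_insert]
      constructor
      · rintro ⟨hf, hk, h1, h2⟩
        by_cases h : dep f = b + 1
        · exact Or.inl (hinj f hf e heU (hk.trans hek.symm) (h.trans hed.symm))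
        · exact Or.inr ⟨hf, hk, h1, by omega⟩
      · rintro (rfl | ⟨hf, hk, h1, h2⟩)
        · exact ⟨heU, hek, by omega, by omega⟩
        · exact ⟨hf, hk, h1, by omega⟩
    rw [this, Finset.sum_insert he, ih fun n h1 h2 => hb n h1 (by omega), hek, hed]
    simp

variable {J : Type*} [Fintype J]

variable (U leg) in
/-- The maximum value of an edge-disjoint packing in the union of the legs `i` and `j`; for
`i = j` the leg is counted twice. -/
def pairWeight (Q : J → Finset E) (v : J → ℝ≥0) (i j : ι) : ℝ :=
  if i = j then 2 * opt Q v (legSet U leg i) else opt Q v (legSet U leg i ∪ legSet U leg j)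

/-- A demand in leg coordinates: a segment of one leg, or initial segments of two legs. -/
def IsLegDemand (U : Finset E) (leg : E → ι) (dep : E → ℕ) (q : Finset E) : Prop :=
  (∃ k a b, a < b ∧ (∃ e ∈ U, leg e = k ∧ dep e = b) ∧ q = seg U leg dep k a b) ∨
  (∃ k l a b, k ≠ l ∧ (∃ e ∈ U, leg e = k ∧ dep e = a) ∧ (∃ e ∈ U, leg e = l ∧ dep e = b) ∧
    ∀ e, e ∈ q ↔ e ∈ seg U leg dep k 0 a ∨ e ∈ seg U leg dep l 0 b)

theorem exists_prices [Fintype ι] (hdep : ∀ e ∈ U, 1 ≤ dep e)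
    (hinj : ∀ e ∈ U, ∀ f ∈ U, leg e = leg f → dep e = dep f → e = f)
    (hdown : ∀ e ∈ U, ∀ n, 1 ≤ n → n ≤ dep e → ∃ f ∈ U, leg f = leg e ∧ dep f = n)
    {Q : J → Finset E} {v : J → ℝ≥0} (hne : ∀ j, (Q j).Nonempty)
    (hQ : ∀ j, IsLegDemand U leg dep (Q j)) (r : ι → ℝ)
    (hr : ∀ i j, pairWeight U leg Q v i j ≤ r i + r j) :
    ∃ p : E → ℝ, (∀ e, 0 ≤ p e) ∧ (∀ j, (v j : ℝ) ≤ ∑ e ∈ Q j, p e) ∧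
      ∑ e ∈ U, p e ≤ ∑ i, r i := by
  set W : ι → ι → ℕ → ℝ := fun i k n =>
    if i = k then opt Q v (legSet U leg k) + opt Q v (seg U leg dep k 0 n)
    else opt Q v (legSet U leg i ∪ seg U leg dep k 0 n) with hW
  set d : ι → ℕ → ℝ := fun k n => opt Q v (outer U leg dep k n) with hd
  set ψ : ι → ℕ → ℝ := fun k n =>
    Finset.univ.sup' ⟨k, Finset.mem_univ k⟩ fun i => W i k n - r i with hψ
  set F : ι → ℕ → ℝ := fun k n => if n = 0 then 0 else (r k - d k n + ψ k n) / 2 with hF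
  have hseg_leg : ∀ k a b, seg U leg dep k a b ⊆ legSet U leg k := fun k a b e he => by
    simp only [seg, legSet, Finset.mem_filter] at he ⊢; exact ⟨he.1, he.2.1⟩
  have hd0 : ∀ k n, 0 ≤ d k n := fun k n => NNReal.coe_nonneg _
  have hdD : ∀ k n, d k n ≤ opt Q v (legSet U leg k) := fun k n => opt_mono fun e he => by
    simp only [outer, legSet, Finset.mem_filter] at he ⊢; exact ⟨he.1, he.2.1⟩
  have hDr : ∀ k, (opt Q v (legSet U leg k) : ℝ) ≤ r k := fun k => by
    have := hr k k
    rw [pairWeight, if_pos rfl] at this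
    linarith
  have hψW : ∀ i k n, W i k n - r i ≤ ψ k n := fun i k n =>
    Finset.le_sup' (fun i => W i k n - r i) (Finset.mem_univ i)
  have hψr : ∀ k n, ψ k n ≤ r k := fun k n => Finset.sup'_le _ _ fun i _ => by
    have h1 := hr i k
    have h2 : W i k n ≤ pairWeight U leg Q v i k := by
      simp only [hW, pairWeight]
      split_ifs with h
      · subst h
        have := opt_mono (Q := Q) (v := v) (hseg_leg i 0 n)
        linarith
      · exact opt_mono (Finset.union_subset_union_right (hseg_leg k 0 n))
    linarith
  have hWadd : ∀ i k a b x (G : Finset E), a ≤ b → G ⊆ seg U leg dep k a b →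
      x ≤ (opt Q v G : ℝ) → W i k a + x ≤ W i k b := by
    intro i k a b x G hab hG hx
    have hda : Disjoint (seg U leg dep k 0 a) G :=
      Finset.disjoint_of_subset_right hG (Finset.disjoint_left.2 fun e he he' => by
        simp only [seg, Finset.mem_filter] at he he'; omega)
    have hsub : seg U leg dep k 0 a ⊆ seg U leg dep k 0 b := fun e he => by
      simp only [seg, Finset.mem_filter] at he ⊢; exact ⟨he.1, he.2.1, he.2.2.1, by omega⟩
    have hsub' : G ⊆ seg U leg dep k 0 b := fun e he => by
      have he := hG he
      simp only [seg, Finset.mem_filter] at he ⊢; exact ⟨he.1, he.2.1, by omega, by omega⟩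
    simp only [hW]
    split_ifs with h
    · have := opt_add_opt_le (v := v) hne hda hsub hsub'
      linarith
    · have hdi : Disjoint (legSet U leg i ∪ seg U leg dep k 0 a) G := by
        rw [Finset.disjoint_union_left]
        refine ⟨Finset.disjoint_left.2 fun e he he' => h ?_, hda⟩
        have he' := hG he'
        simp only [seg, legSet, Finset.mem_filter] at he he'
        rw [← he.2, ← he'.2.1]
      have := opt_add_opt_le (v := v) hne hdi
        (Finset.union_subset_union_right (s := legSet U leg i) hsub)
        (hsub'.trans Finset.subset_union_right)
      linarith
  have hψadd : ∀ k a b x (G : Finset E), a ≤ b → G ⊆ seg U leg dep k a b →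
      x ≤ (opt Q v G : ℝ) → ψ k a + x ≤ ψ k b := by
    intro k a b x G hab hG hx
    obtain ⟨i, -, hi⟩ := Finset.exists_mem_eq_sup' (⟨k, Finset.mem_univ k⟩ : Finset.univ.Nonempty)
      fun i => W i k a - r i
    have h1 := hWadd i k a b x G hab hG hx
    have h2 := hψW i k b
    have h3 : ψ k a = W i k a - r i := hi
    linarith
  have hdadd : ∀ k a b x (G : Finset E), a ≤ b → G ⊆ seg U leg dep k a b →
      x ≤ (opt Q v G : ℝ) → d k b + x ≤ d k a := by
    intro k a b x G hab hG hx
    have h := opt_add_opt_le (v := v) hne (F := outer U leg dep k b) (F' := G)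
      (H := outer U leg dep k a)
      (Finset.disjoint_of_subset_right hG (Finset.disjoint_left.2 fun e he he' => by
        simp only [seg, outer, Finset.mem_filter] at he he'; omega))
      (fun e he => by simp only [outer, Finset.mem_filter] at he ⊢; exact ⟨he.1, he.2.1, by omega⟩)
      (fun e he => by
        have he := hG he
        simp only [seg, outer, Finset.mem_filter] at he ⊢; exact ⟨he.1, he.2.1, by omega⟩)
    simp only [hd]
    linarith
  have hFadd : ∀ k a b x (G : Finset E), a < b → G ⊆ seg U leg dep k a b →
      x ≤ (opt Q v G : ℝ) → x ≤ F k b - F k a := by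
    intro k a b x G hab hG hx
    have h1 := hψadd k a b x G hab.le hG hx
    have h2 := hdadd k a b x G hab.le hG hx
    simp only [hF, if_neg (show b ≠ 0 by omega)]
    split_ifs with h
    · subst h
      have h3 := hψW k k 0
      simp only [hW, if_true] at h3
      have h4 := hdD k 0
      have h5 : (0 : ℝ) ≤ opt Q v (seg U leg dep k 0 0) := NNReal.coe_nonneg _
      linarith
    · linarith
  have hcross : ∀ k l a b x (G : Finset E), k ≠ l → a ≠ 0 → b ≠ 0 → x ≤ (opt Q v G : ℝ) →
      (∀ e ∈ G, e ∈ seg U leg dep k 0 a ∨ e ∈ seg U leg dep l 0 b) →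
      d k a + x - r k ≤ ψ l b := by
    intro k l a b x G hkl ha hb hx hG
    have h1 := hψW k l b
    simp only [hW, if_neg hkl] at h1
    have h := opt_add_opt_le (v := v) hne (F := outer U leg dep k a) (F' := G)
      (H := legSet U leg k ∪ seg U leg dep l 0 b)
      (Finset.disjoint_left.2 fun e he he' => by
        have he' := hG e he'
        simp only [seg, outer, Finset.mem_filter] at he he'
        rcases he' with he' | he'
        · omega
        · exact hkl (he.2.1.symm.trans he'.2.1))
      (fun e he => by
        simp only [outer, legSet, Finset.mem_union, Finset.mem_filter] at he ⊢
        exact Or.inl ⟨he.1, he.2.1⟩)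
      (fun e he => by
        rcases hG e he with he | he
        · exact Finset.mem_union_left _ (hseg_leg k 0 a he)
        · exact Finset.mem_union_right _ he)
    simp only [hd]
    linarith
  have hreal : ∀ k b, (∃ e ∈ U, leg e = k ∧ dep e = b) →
      ∀ n, 1 ≤ n → n ≤ b → ∃ e ∈ U, leg e = k ∧ dep e = n := by
    rintro k b ⟨e, he, rfl, rfl⟩ n h1 h2
    exact hdown e he n h1 h2
  refine ⟨fun e => F (leg e) (dep e) - F (leg e) (dep e - 1), fun e => ?_, fun j => ?_, ?_⟩
  · rcases Nat.eq_zero_or_pos (dep e) with h | h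
    · simp [h]
    · exact hFadd _ _ _ 0 ∅ (by omega) (Finset.empty_subset _) (NNReal.coe_nonneg _)
  · rcases hQ j with ⟨k, a, b, hab, hb, hq⟩ | ⟨k, l, a, b, hkl, ha, hb, hq⟩
    · rw [hq, sum_seg hinj F hab.le (hreal k b hb)]
      exact hFadd k a b _ (Q j) hab hq.subset (le_opt subset_rfl)
    · have hqu : Q j = seg U leg dep k 0 a ∪ seg U leg dep l 0 b := by
        ext e; rw [hq, Finset.mem_union]
      have hdis : Disjoint (seg U leg dep k 0 a) (seg U leg dep l 0 b) :=
        Finset.disjoint_left.2 fun e he he' => by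
          simp only [seg, Finset.mem_filter] at he he'
          exact hkl (he.2.1.symm.trans he'.2.1)
      have ha0 : a ≠ 0 := by
        obtain ⟨e, he, -, h⟩ := ha; have := hdep e he; omega
      have hb0 : b ≠ 0 := by
        obtain ⟨e, he, -, h⟩ := hb; have := hdep e he; omega
      have h1 := hcross k l a b _ (Q j) hkl ha0 hb0 (le_opt subset_rfl) fun e he => (hq e).1 he
      have h2 := hcross l k b a _ (Q j) hkl.symm hb0 ha0 (le_opt subset_rfl)
        fun e he => ((hq e).1 he).symm
      rw [hqu, Finset.sum_union hdis, sum_seg hinj F (Nat.zero_le _) (hreal k a ha),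
        sum_seg hinj F (Nat.zero_le _) (hreal l b hb)]
      simp only [hF, if_neg ha0, if_neg hb0, if_true]
      linarith
  · rw [← Finset.sum_fiberwise U leg]
    refine Finset.sum_le_sum fun k _ => ?_
    rcases (legSet U leg k).eq_empty_or_nonempty with h | h
    · have h' : (U.filter fun e => leg e = k) = ∅ := h
      rw [h', Finset.sum_empty]
      exact (NNReal.coe_nonneg _).trans (hDr k)
    · obtain ⟨e, he, hmax⟩ := Finset.exists_max_image _ dep h
      have he' := (Finset.mem_filter.1 he)
      have hs : (U.filter fun e => leg e = k) = seg U leg dep k 0 (dep e) := by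
        ext f
        simp only [seg, Finset.mem_filter]
        constructor
        · rintro ⟨h1, h2⟩
          exact ⟨h1, h2, hdep f h1, hmax f (Finset.mem_filter.2 ⟨h1, h2⟩)⟩
        · rintro ⟨h1, h2, -⟩
          exact ⟨h1, h2⟩
      rw [hs, sum_seg hinj F (Nat.zero_le _) (hreal k _ ⟨e, he'.1, he'.2, rfl⟩)]
      have h0 := hdep e he'.1
      have h1 := hψr k (dep e)
      have h2 := hd0 k (dep e)
      simp only [hF, if_neg (show dep e ≠ 0 by omega), if_true]
      linarith

end Legs

end Tollbooth

namespace Tollbooth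

section Cover

variable {E ι J : Type*} [Fintype J] {U : Finset E} {leg : E → ι} {dep : E → ℕ}
  {Q : J → Finset E} {v : J → ℝ≥0}

theorem exists_double_packing [Fintype ι] (hne : ∀ j, (Q j).Nonempty) (π : Equiv.Perm ι) :
    ∃ M : Finset (ι × Bool × J), (∀ e, (M.filter fun m => e ∈ Q m.2.2).card ≤ 2) ∧
      ∑ m ∈ M, (v m.2.2 : ℝ) = ∑ i, pairWeight U leg Q v i (π i) := by
  set G : ι → Bool → Finset E := fun i b =>
    if i = π i then legSet U leg i
    else if b then legSet U leg i ∪ legSet U leg (π i) else ∅ with hG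
  choose S hSG hSd hSv using fun i b => exists_sum_eq_opt Q v (G i b)
  refine ⟨Finset.univ.filter fun m => m.2.2 ∈ S m.1 m.2.1, fun e => ?_, ?_⟩
  · set T : Finset (ι × Bool) := if π (leg e) = leg e then {(leg e, true), (leg e, false)}
      else {(leg e, true), (π.symm (leg e), true)} with hT
    have hTcard : T.card ≤ 2 := by
      rw [hT]; split_ifs <;> exact Finset.card_le_two
    refine le_trans (Finset.card_le_card_of_injOn (fun m => (m.1, m.2.1)) ?_ ?_) hTcard
    · rintro ⟨i, b, j⟩ hm
      simp only [Finset.coe_filter, Finset.mem_filter, Finset.mem_univ, true_and,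
        Set.mem_ofPred_eq] at hm
      have he := hSG i b j hm.1 hm.2
      simp only [hG] at he
      simp only [Finset.mem_coe, hT]
      by_cases hi : i = π i
      · rw [if_pos hi] at he
        have hk : leg e = i := (Finset.mem_filter.1 he).2
        rw [hk, if_pos hi.symm]
        cases b <;> simp
      · rw [if_neg hi] at he
        cases b with
        | false => simp at he
        | true =>
          simp only [if_true, Finset.mem_union, legSet, Finset.mem_filter] at he
          rcases he with ⟨-, hk⟩ | ⟨-, hk⟩
          · rw [hk, if_neg (Ne.symm hi)]; simp
          · have hk' : ¬ π (leg e) = leg e := by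
              rw [hk]; intro h; exact hi (π.injective h).symm
            rw [if_neg hk', hk]; simp
    · rintro ⟨i, b, j⟩ hm ⟨i', b', j'⟩ hm' h
      simp only [Finset.coe_filter, Finset.mem_filter, Finset.mem_univ, true_and,
        Set.mem_ofPred_eq] at hm hm'
      obtain ⟨rfl, rfl⟩ := Prod.mk.inj h
      by_contra hjj
      have hjj' : j ≠ j' := by rintro rfl; exact hjj rfl
      exact Finset.disjoint_left.1 (hSd _ _ hm.1 hm'.1 hjj') hm.2 hm'.2
  · rw [Finset.sum_filter, Fintype.sum_prod_type]
    refine Finset.sum_congr rfl fun i _ => ?_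
    have hS : ∀ b, ∑ j, (if j ∈ S i b then (v j : ℝ) else 0) = opt Q v (G i b) := fun b => by
      rw [← hSv, Finset.sum_ite_mem, Finset.univ_inter, NNReal.coe_sum]
    rw [Fintype.sum_prod_type, Fintype.sum_bool, hS, hS, pairWeight]
    simp only [hG]
    by_cases hi : i = π i
    · simp only [if_pos hi]; ring
    · simp only [if_neg hi, if_true]
      have h0 : opt Q v (∅ : Finset E) = 0 := by
        obtain ⟨S', h1, -, h3⟩ := exists_sum_eq_opt Q v (∅ : Finset E)
        rw [← h3]
        refine Finset.sum_eq_zero fun j hj => ?_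
        exact absurd (Finset.subset_empty.1 (h1 j hj)) (hne j).ne_empty
      simp [h0]

theorem IsLegDemand.exists_form {q : Finset E}
    (hq : IsLegDemand U leg dep q) : ∃ (a : ℕ) (K : Finset ι) (b : ι → ℕ), K.card ≤ 2 ∧
      ∀ e, e ∈ q ↔ e ∈ U ∧ leg e ∈ K ∧ a < dep e ∧ dep e ≤ b (leg e) := by
  rcases hq with ⟨k, a, b, -, -, rfl⟩ | ⟨k, l, a, b, hkl, -, -, hq⟩
  · refine ⟨a, {k}, fun _ => b, by simp, fun e => ?_⟩
    simp [seg]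
  · refine ⟨0, {k, l}, fun i => if i = k then a else b, Finset.card_le_two, fun e => ?_⟩
    rw [hq]
    simp only [seg, Finset.mem_filter, Finset.mem_insert, Finset.mem_singleton]
    constructor
    · rintro (⟨h1, h2, h3, h4⟩ | ⟨h1, h2, h3, h4⟩)
      · exact ⟨h1, Or.inl h2, h3, by rwa [if_pos h2]⟩
      · exact ⟨h1, Or.inr h2, h3, by rwa [if_neg (by rw [h2]; exact hkl.symm)]⟩
    · rintro ⟨h1, h2 | h2, h3, h4⟩
      · rw [if_pos h2] at h4; exact Or.inl ⟨h1, h2, h3, h4⟩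
      · rw [if_neg (by rw [h2]; exact hkl.symm)] at h4; exact Or.inr ⟨h1, h2, h3, h4⟩

omit [Fintype J] in
theorem exists_rank_top
    (hinj : ∀ e ∈ U, ∀ f ∈ U, leg e = leg f → dep e = dep f → e = f)
    (hQ : ∀ j, IsLegDemand U leg dep (Q j)) :
    ∃ rank : J → ℕ, ∀ j, ∃ T : Finset E, T ⊆ Q j ∧ T.card ≤ 2 ∧
      ∀ j', rank j' ≤ rank j → ¬ Disjoint (Q j') (Q j) → ¬ Disjoint (Q j') T := by
  choose rank K b hK hform using fun j => (hQ j).exists_form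
  refine ⟨rank, fun j => ?_⟩
  refine ⟨(Q j).filter fun f => ∀ e ∈ Q j, leg e = leg f → dep f ≤ dep e,
    Finset.filter_subset _ _, ?_, ?_⟩
  · refine le_trans (Finset.card_le_card_of_injOn leg ?_ ?_) (hK j)
    · intro f hf
      exact ((hform j f).1 (Finset.mem_filter.1 hf).1).2.1
    · intro f hf g hg hfg
      obtain ⟨hf1, hf2⟩ := Finset.mem_filter.1 hf
      obtain ⟨hg1, hg2⟩ := Finset.mem_filter.1 hg
      exact hinj f ((hform j f).1 hf1).1 g ((hform j g).1 hg1).1 hfg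
        (le_antisymm (hf2 g hg1 hfg.symm) (hg2 f hf1 hfg))
  · intro j' hrank hdis
    obtain ⟨e, he', he⟩ := Finset.not_disjoint_iff.1 hdis
    obtain ⟨f, hf, hmin⟩ := Finset.exists_min_image ((Q j).filter fun f => leg f = leg e) dep
      ⟨e, Finset.mem_filter.2 ⟨he, rfl⟩⟩
    obtain ⟨hfQ, hfe⟩ := Finset.mem_filter.1 hf
    refine Finset.not_disjoint_iff.2 ⟨f, (hform j' f).2 ?_, Finset.mem_filter.2 ⟨hfQ, ?_⟩⟩
    · obtain ⟨h1, h2, h3, h4⟩ := (hform j f).1 hfQ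
      obtain ⟨h1', h2', h3', h4'⟩ := (hform j' e).1 he'
      rw [hfe]
      have := hmin e (Finset.mem_filter.2 ⟨he, rfl⟩)
      exact ⟨h1, h2', by omega, by omega⟩
    · intro g hg hgf
      exact hmin g (Finset.mem_filter.2 ⟨hg, hgf.trans hfe⟩)

theorem pairWeight_comm (i j : ι) : pairWeight U leg Q v i j = pairWeight U leg Q v j i := by
  by_cases h : i = j
  · rw [h]
  · rw [pairWeight, pairWeight, if_neg h, if_neg (Ne.symm h), Finset.union_comm]

theorem pairWeight_nonneg (i j : ι) : 0 ≤ pairWeight U leg Q v i j := by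
  rw [pairWeight]; split_ifs <;> positivity

/-- In leg coordinates there are prices, at least the value of each demand, for which some
edge-disjoint family of tightly priced demands has two thirds of the maximum value. -/
theorem exists_tight_prices [Fintype ι] (hdep : ∀ e ∈ U, 1 ≤ dep e)
    (hinj : ∀ e ∈ U, ∀ f ∈ U, leg e = leg f → dep e = dep f → e = f)
    (hdown : ∀ e ∈ U, ∀ n, 1 ≤ n → n ≤ dep e → ∃ f ∈ U, leg f = leg e ∧ dep f = n)
    (hne : ∀ j, (Q j).Nonempty) (hQ : ∀ j, IsLegDemand U leg dep (Q j)) :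
    ∃ p : E → ℝ, (∀ e, 0 ≤ p e) ∧ (∀ j, (v j : ℝ) ≤ ∑ e ∈ Q j, p e) ∧
      ∃ S : Finset J, ((S : Set J).Pairwise fun j k => Disjoint (Q j) (Q k)) ∧
        (∀ j ∈ S, ∑ e ∈ Q j, p e = v j) ∧
        ∀ S' : Finset J, ((S' : Set J).Pairwise fun j k => Disjoint (Q j) (Q k)) →
          2 / 3 * ∑ j ∈ S', (v j : ℝ) ≤ ∑ j ∈ S, (v j : ℝ) := by
  obtain ⟨r, hr, π, hπ⟩ := exists_symmetric_cover (pairWeight U leg Q v) pairWeight_comm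
    pairWeight_nonneg
  obtain ⟨p, hp0, hpv, hpU⟩ := exists_prices hdep hinj hdown hne hQ r hr
  obtain ⟨M, hload, hM⟩ := exists_double_packing (U := U) (leg := leg) (v := v) hne π
  obtain ⟨rank, htop⟩ := exists_rank_top hinj hQ
  obtain ⟨col, hcol⟩ := exists_three_coloring M (fun m => Q m.2.2) (fun m => rank m.2.2) hload
    fun m _ => by
      obtain ⟨T, h1, h2, h3⟩ := htop m.2.2
      exact ⟨T, h1, h2, fun m' _ => h3 m'.2.2⟩
  have hQU : ∀ j, Q j ⊆ U := fun j e he => by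
    obtain ⟨a, K, b, -, h⟩ := (hQ j).exists_form
    exact ((h e).1 he).1
  have hMr : ∑ m ∈ M, (v m.2.2 : ℝ) = 2 * ∑ i, r i := by
    rw [hM, ← Finset.sum_congr rfl fun i _ => hπ i, Finset.sum_add_distrib, Equiv.sum_comp π r]
    ring
  have hMp : ∑ m ∈ M, ∑ e ∈ Q m.2.2, p e ≤ 2 * ∑ e ∈ U, p e := by
    have h1 : ∀ m ∈ M, ∑ e ∈ Q m.2.2, p e = ∑ e ∈ U, if e ∈ Q m.2.2 then p e else 0 :=
      fun m _ => by rw [Finset.sum_ite_mem, Finset.inter_eq_right.2 (hQU _)]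
    rw [Finset.sum_congr rfl h1, Finset.sum_comm, Finset.mul_sum]
    refine Finset.sum_le_sum fun e _ => ?_
    rw [← Finset.sum_filter, Finset.sum_const, nsmul_eq_mul]
    exact mul_le_mul_of_nonneg_right (by exact_mod_cast hload e) (hp0 e)
  have htight : ∀ m ∈ M, (v m.2.2 : ℝ) = ∑ e ∈ Q m.2.2, p e :=
    (Finset.sum_eq_sum_iff_of_le fun m _ => hpv m.2.2).1
      (le_antisymm (Finset.sum_le_sum fun m _ => hpv m.2.2) (by linarith))
  have hopt : ∀ S' : Finset J, ((S' : Set J).Pairwise fun j k => Disjoint (Q j) (Q k)) →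
      ∑ j ∈ S', (v j : ℝ) ≤ ∑ i, r i := by
    intro S' hS'
    calc ∑ j ∈ S', (v j : ℝ) ≤ ∑ j ∈ S', ∑ e ∈ Q j, p e := Finset.sum_le_sum fun j _ => hpv j
      _ = ∑ e ∈ S'.biUnion Q, p e := (Finset.sum_biUnion hS').symm
      _ ≤ ∑ e ∈ U, p e := Finset.sum_le_sum_of_subset_of_nonneg
          (Finset.biUnion_subset.2 fun j _ => hQU j) fun e _ _ => hp0 e
      _ ≤ ∑ i, r i := hpU
  obtain ⟨c, -, hc⟩ : ∃ c ∈ (Finset.univ : Finset (Fin 3)), (2 * ∑ i, r i) / 3 ≤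
      ∑ m ∈ M.filter fun m => col m = c, (v m.2.2 : ℝ) := by
    apply Finset.exists_le_of_sum_le Finset.univ_nonempty
    rw [Finset.sum_fiberwise, hMr]
    simp only [Finset.sum_const, Finset.card_univ, Fintype.card_fin, nsmul_eq_mul]
    apply le_of_eq
    push_cast
    ring
  have hdisj : ∀ m ∈ M.filter (fun m => col m = c), ∀ m' ∈ M.filter (fun m => col m = c),
      m ≠ m' → Disjoint (Q m.2.2) (Q m'.2.2) := fun m hm m' hm' h => by
    rw [Finset.mem_filter] at hm hm'
    exact hcol m hm.1 m' hm'.1 h (hm.2.trans hm'.2.symm)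
  refine ⟨p, hp0, hpv, (M.filter fun m => col m = c).image fun m => m.2.2, ?_, ?_, ?_⟩
  · intro j hj k hk hjk
    rw [Finset.mem_coe, Finset.mem_image] at hj hk
    obtain ⟨m, hm, rfl⟩ := hj
    obtain ⟨m', hm', rfl⟩ := hk
    exact hdisj m hm m' hm' fun h => hjk (by rw [h])
  · intro j hj
    obtain ⟨m, hm, rfl⟩ := Finset.mem_image.1 hj
    exact (htight m (Finset.mem_filter.1 hm).1).symm
  · intro S' hS'
    rw [Finset.sum_image]
    · have := hopt S' hS'
      linarith
    · intro m hm m' hm' h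
      by_contra hmm
      have hd := hdisj m hm m' hm' hmm
      simp only at h
      rw [h, disjoint_self] at hd
      exact (hne m'.2.2).ne_empty hd

end Cover

end Tollbooth

namespace Tollbooth

theorem isLegDemand_of_xor {E ι : Type*} {U : Finset E} {leg : E → ι} {dep : E → ℕ} {k l : ι}
    {a b : ℕ} {q : Finset E} (ha : 0 < a → ∃ e ∈ U, leg e = k ∧ dep e = a)
    (hb : 0 < b → ∃ e ∈ U, leg e = l ∧ dep e = b) (hne : q.Nonempty)
    (hq : ∀ e, e ∈ q ↔ Xor (e ∈ seg U leg dep k 0 a) (e ∈ seg U leg dep l 0 b)) :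
    IsLegDemand U leg dep q := by
  wlog hab : a ≤ b generalizing a b k l
  · exact this hb ha (fun e => by rw [hq, xor_comm]) (by omega)
  simp only [Xor, seg, Finset.mem_filter] at hq
  obtain ⟨e₀, he₀⟩ := hne
  have he₀ := (hq e₀).1 he₀
  by_cases hkl : k = l
  · subst hkl
    have hlt : a < b := by
      rcases he₀ with ⟨⟨h1, h2, h3, h4⟩, h5⟩ | ⟨⟨h1, h2, h3, h4⟩, h5⟩ <;>
      · by_contra h
        exact h5 ⟨h1, h2, h3, by omega⟩
    refine Or.inl ⟨k, a, b, hlt, hb (by omega), ?_⟩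
    ext e
    rw [hq]
    simp only [seg, Finset.mem_filter]
    constructor
    · rintro (⟨⟨h1, h2, h3, h4⟩, h5⟩ | ⟨⟨h1, h2, h3, h4⟩, h5⟩)
      · exact absurd ⟨h1, h2, h3, by omega⟩ h5
      · exact ⟨h1, h2, by by_contra h6; exact h5 ⟨h1, h2, h3, by omega⟩, h4⟩
    · rintro ⟨h1, h2, h3, h4⟩
      exact Or.inr ⟨⟨h1, h2, by omega, h4⟩, fun h => by omega⟩
  · have hb0 : 0 < b := by
      rcases he₀ with ⟨⟨-, -, h3, h4⟩, -⟩ | ⟨⟨-, -, h3, h4⟩, -⟩ <;> omega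
    rcases Nat.eq_zero_or_pos a with rfl | ha0
    · refine Or.inl ⟨l, 0, b, hb0, hb hb0, ?_⟩
      ext e
      rw [hq]
      simp only [seg, Finset.mem_filter]
      constructor
      · rintro (⟨⟨-, -, h3, h4⟩, -⟩ | ⟨h, -⟩)
        · omega
        · exact h
      · exact fun h => Or.inr ⟨h, fun h' => by omega⟩
    · refine Or.inr ⟨k, l, a, b, hkl, ha ha0, hb hb0, fun e => ?_⟩
      rw [hq]
      simp only [seg, Finset.mem_filter]
      constructor
      · rintro (⟨h, -⟩ | ⟨h, -⟩)
        · exact Or.inl h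
        · exact Or.inr h
      · rintro (h | h)
        · exact Or.inl ⟨h, fun h' => hkl (h.2.1.symm.trans h'.2.1)⟩
        · exact Or.inr ⟨h, fun h' => hkl (h'.2.1.symm.trans h.2.1)⟩

section Graph

variable {V : Type*} {G : SimpleGraph V}

theorem eq_of_adj_of_dist_eq (hG : G.IsTree) {c x y z : V} (hxy : G.Adj x y) (hxz : G.Adj x z)
    (hy : G.dist c x = G.dist c y + 1) (hz : G.dist c x = G.dist c z + 1) : y = z := by
  obtain ⟨p, -, hp⟩ := hG.connected.exists_path_of_dist c y
  obtain ⟨q, -, hq⟩ := hG.connected.exists_path_of_dist c z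
  have hp' : (p.concat hxy.symm).IsPath := SimpleGraph.Walk.isPath_of_length_eq_dist _ (by
    rw [SimpleGraph.Walk.length_concat, hp, hy])
  have hq' : (q.concat hxz.symm).IsPath := SimpleGraph.Walk.isPath_of_length_eq_dist _ (by
    rw [SimpleGraph.Walk.length_concat, hq, hz])
  have h := (hG.existsUnique_path c x).unique hp' hq'
  simpa using congrArg SimpleGraph.Walk.penultimate h

theorem exists_adj_dist_eq (hG : G.IsTree) {c x : V} (hx : x ≠ c) :
    ∃ y, G.Adj x y ∧ G.dist c x = G.dist c y + 1 := by
  obtain ⟨p, hp⟩ := hG.connected.exists_walk_length_eq_dist x c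
  cases p with
  | nil => exact absurd rfl hx
  | cons h p =>
    refine ⟨_, h, ?_⟩
    have h1 := SimpleGraph.dist_le p
    rw [SimpleGraph.Walk.length_cons, SimpleGraph.dist_comm] at hp
    rw [SimpleGraph.dist_comm] at h1
    rcases hG.dist_eq_dist_add_one_of_adj c h with h2 | h2 <;> omega

theorem mem_edges_iff_xor {A : V → Finset (Sym2 V)}
    (hA : ∀ x y, G.Adj x y → ∀ e, Xor (e ∈ A x) (e ∈ A y) ↔ e = s(x, y)) {a b : V}
    (W : G.Walk a b) (hW : W.IsTrail) (e : Sym2 V) :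
    e ∈ W.edges ↔ Xor (e ∈ A a) (e ∈ A b) := by
  induction W with
  | nil => simp
  | cons h p ih =>
    rw [SimpleGraph.Walk.isTrail_cons] at hW
    have h1 := ih hW.1
    have h2 := hA _ _ h e
    have h3 : e = _ → e ∉ p.edges := fun he => he ▸ hW.2
    rw [SimpleGraph.Walk.edges_cons, List.mem_cons, ← h2]
    rw [← h2] at h3
    rw [h1] at h3 ⊢
    simp only [Xor] at h3 ⊢
    tauto

/-- Every edge of a rooted spider gets a leg and a depth in which all demand paths are segments
of a leg or unions of initial segments of two legs. -/
theorem exists_leg_coordinates [Fintype V] (hG : G.IsTree) {c : V}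
    (hc : ∀ x, x ≠ c → G.degree x ≤ 2) :
    ∃ (leg : Sym2 V → V) (dep : Sym2 V → ℕ), (∀ e ∈ G.edgeFinset, 1 ≤ dep e) ∧
      (∀ e ∈ G.edgeFinset, ∀ f ∈ G.edgeFinset, leg e = leg f → dep e = dep f → e = f) ∧
      (∀ e ∈ G.edgeFinset, ∀ n, 1 ≤ n → n ≤ dep e →
        ∃ f ∈ G.edgeFinset, leg f = leg e ∧ dep f = n) ∧
      ∀ (a b : V) (W : G.Walk a b), W.IsPath → W.edges ≠ [] → ∀ q : Finset (Sym2 V),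
        (∀ e, e ∈ q ↔ e ∈ W.edges) → IsLegDemand G.edgeFinset leg dep q := by
  have hpar : ∀ x, ∃ y, x ≠ c → G.Adj x y ∧ G.dist c x = G.dist c y + 1 := fun x => by
    by_cases hx : x = c
    · exact ⟨c, fun h => absurd hx h⟩
    · obtain ⟨y, hy⟩ := exists_adj_dist_eq hG hx
      exact ⟨y, fun _ => hy⟩
  choose par hpar using hpar
  have hpar_eq : ∀ x y, G.Adj x y → G.dist c x = G.dist c y + 1 → par x = y := fun x y h h' => by
    have hx : x ≠ c := by rintro rfl; simp at h'
    exact eq_of_adj_of_dist_eq hG (hpar x hx).1 h (hpar x hx).2 h'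
  have hpos : ∀ x, x ≠ c ↔ 0 < G.dist c x := fun x => by
    rw [Nat.pos_iff_ne_zero, Ne, Ne, hG.connected.dist_eq_zero_iff, eq_comm]
  have hchild : ∀ x y z, x ≠ c → G.Adj x y → G.Adj x z → G.dist c y = G.dist c x + 1 →
      G.dist c z = G.dist c x + 1 → y = z := by
    intro x y z hx hy hz hdy hdz
    by_contra hyz
    obtain ⟨hw, hdw⟩ := hpar x hx
    have hwy : par x ≠ y := by intro h; rw [h] at hdw; omega
    have hwz : par x ≠ z := by intro h; rw [h] at hdw; omega
    have hsub : ({par x, y, z} : Finset V) ⊆ G.neighborFinset x := by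
      intro u hu
      simp only [Finset.mem_insert, Finset.mem_singleton] at hu
      rw [SimpleGraph.mem_neighborFinset]
      rcases hu with rfl | rfl | rfl <;> assumption
    have h3 := Finset.card_le_card hsub
    rw [Finset.card_eq_three.2 ⟨_, _, _, hwy, hwz, hyz, rfl⟩,
      SimpleGraph.card_neighborFinset_eq_degree] at h3
    have := hc x hx
    omega
  set vleg : V → V := fun x => par^[G.dist c x - 1] x with hvleg
  have hleg_par : ∀ x, 2 ≤ G.dist c x → vleg (par x) = vleg x := by
    intro x hx
    have h := (hpar x ((hpos x).2 (by omega))).2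
    obtain ⟨m, hm⟩ : ∃ m, G.dist c x = m + 2 := ⟨G.dist c x - 2, by omega⟩
    have hm' : G.dist c (par x) = m + 1 := by omega
    simp only [hvleg, hm, hm']
    rfl
  have hvinj : ∀ n x y, G.dist c x = n + 1 → G.dist c y = n + 1 → vleg x = vleg y → x = y := by
    intro n
    induction n with
    | zero =>
      intro x y hx hy h
      simpa [hvleg, hx, hy] using h
    | succ n ih =>
      intro x y hx hy h
      have h1 := hpar x ((hpos x).2 (by omega))
      have h2 := hpar y ((hpos y).2 (by omega))
      rw [← hleg_par x (by omega), ← hleg_par y (by omega)] at h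
      have h3 := ih (par x) (par y) (by omega) (by omega) h
      refine hchild (par x) x y ((hpos _).2 (by omega)) h1.1.symm ?_ h1.2 ?_
      · rw [h3]; exact h2.1.symm
      · rw [h3]; exact h2.2
  have hvdown : ∀ m x n, G.dist c x = m → 1 ≤ n → n ≤ m →
      ∃ y, vleg y = vleg x ∧ G.dist c y = n := by
    intro m
    induction m with
    | zero => intro x n _ _ _; omega
    | succ m ih =>
      intro x n hx h1 h2
      by_cases hn : n = m + 1
      · exact ⟨x, rfl, hx.trans hn.symm⟩
      · have h := (hpar x ((hpos x).2 (by omega))).2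
        obtain ⟨y, hy1, hy2⟩ := ih (par x) n (by omega) h1 (by omega)
        exact ⟨y, hy1.trans (hleg_par x (by omega)), hy2⟩
  have hfar : ∀ e : Sym2 V, ∃ x, e ∈ G.edgeSet → x ≠ c ∧ e = s(x, par x) := by
    intro e
    induction e using Sym2.ind with
    | h x y =>
      by_cases h : G.Adj x y
      · rcases hG.dist_eq_dist_add_one_of_adj c h with h2 | h2
        · refine ⟨x, fun _ => ⟨(hpos x).2 (by omega), ?_⟩⟩
          rw [hpar_eq x y h h2]
        · refine ⟨y, fun _ => ⟨(hpos y).2 (by omega), ?_⟩⟩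
          rw [hpar_eq y x h.symm h2, Sym2.eq_swap]
      · exact ⟨x, fun h' => absurd h' h⟩
  choose far hfar using hfar
  have hmem : ∀ x, x ≠ c → s(x, par x) ∈ G.edgeSet := fun x hx => (hpar x hx).1
  have hfar_eq : ∀ x, x ≠ c → far s(x, par x) = x := by
    intro x hx
    obtain ⟨h1, h2⟩ := hfar _ (hmem x hx)
    rcases Sym2.eq_iff.1 h2 with ⟨h, -⟩ | ⟨h, h'⟩
    · exact h.symm
    · have h3 := (hpar x hx).2
      have h4 := (hpar _ h1).2
      rw [h'] at h3
      rw [← h] at h4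
      omega
  have hedge : ∀ x, x ≠ c → ∃ e ∈ G.edgeFinset, vleg (far e) = vleg x ∧
      G.dist c (far e) = G.dist c x := fun x hx =>
    ⟨_, SimpleGraph.mem_edgeFinset.2 (hmem x hx), by rw [hfar_eq x hx], by rw [hfar_eq x hx]⟩
  have hinj : ∀ e ∈ G.edgeFinset, ∀ f ∈ G.edgeFinset, vleg (far e) = vleg (far f) →
      G.dist c (far e) = G.dist c (far f) → e = f := by
    intro e he f hf h h'
    obtain ⟨h1, h2⟩ := hfar e (SimpleGraph.mem_edgeFinset.1 he)
    obtain ⟨-, h4⟩ := hfar f (SimpleGraph.mem_edgeFinset.1 hf)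
    have h5 := (hpos _).1 h1
    rw [h2, h4, hvinj (G.dist c (far e) - 1) _ (far f) (by omega) (by omega) h]
  have hdep : ∀ e ∈ G.edgeFinset, 1 ≤ G.dist c (far e) := fun e he =>
    (hpos _).1 (hfar e (SimpleGraph.mem_edgeFinset.1 he)).1
  refine ⟨fun e => vleg (far e), fun e => G.dist c (far e), hdep, hinj, ?_, ?_⟩
  · intro e _ n h1 h2
    obtain ⟨y, hy1, hy2⟩ := hvdown _ (far e) n rfl h1 h2
    obtain ⟨f, hf, hf1, hf2⟩ := hedge y ((hpos y).2 (by omega))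
    exact ⟨f, hf, hf1.trans hy1, hf2.trans hy2⟩
  set pre : V → Finset (Sym2 V) := fun x =>
    seg G.edgeFinset (fun e => vleg (far e)) (fun e => G.dist c (far e)) (vleg x) 0 (G.dist c x)
    with hpre
  have hpre_child : ∀ x y, G.Adj x y → G.dist c y = G.dist c x + 1 →
      ∀ e, Xor (e ∈ pre x) (e ∈ pre y) ↔ e = s(x, y) := by
    intro x y h hd e
    have hy : y ≠ c := (hpos y).2 (by omega)
    have hyx : par y = x := hpar_eq y x h.symm hd
    have hexy : s(x, y) = s(y, par y) := by rw [hyx, Sym2.eq_swap]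
    have hfe : far s(x, y) = y := by rw [hexy]; exact hfar_eq y hy
    have hxy_mem : s(x, y) ∈ G.edgeFinset := SimpleGraph.mem_edgeFinset.2 h
    have hpx : e ∈ pre x ↔ e ∈ G.edgeFinset ∧ vleg (far e) = vleg y ∧
        G.dist c (far e) ≤ G.dist c x := by
      simp only [hpre, seg, Finset.mem_filter]
      constructor
      · rintro ⟨h1, h2, h3, h4⟩
        exact ⟨h1, by rw [h2, ← hyx, hleg_par y (by omega)], h4⟩
      · rintro ⟨h1, h2, h4⟩
        have := hdep e h1
        exact ⟨h1, by rw [h2, ← hyx, hleg_par y (by omega)], by omega, h4⟩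
    have hpy : e ∈ pre y ↔ e ∈ pre x ∨ e = s(x, y) := by
      rw [hpx]
      simp only [hpre, seg, Finset.mem_filter]
      constructor
      · rintro ⟨h1, h2, h3, h4⟩
        by_cases h5 : G.dist c (far e) ≤ G.dist c x
        · exact Or.inl ⟨h1, h2, h5⟩
        · exact Or.inr (hinj e h1 _ hxy_mem (by rw [h2, hfe]) (by rw [hfe]; omega))
      · rintro (⟨h1, h2, h4⟩ | rfl)
        · have := hdep e h1
          exact ⟨h1, h2, by omega, by omega⟩
        · exact ⟨hxy_mem, by rw [hfe], by rw [hfe]; omega, by rw [hfe]⟩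
    have hnot : e = s(x, y) → e ∉ pre x := by
      rintro rfl h1
      have := (hpx.1 h1).2.2
      rw [hfe] at this
      omega
    rw [hpy, Xor]
    tauto
  have hpre_adj : ∀ x y, G.Adj x y → ∀ e, Xor (e ∈ pre x) (e ∈ pre y) ↔ e = s(x, y) := by
    intro x y h e
    rcases hG.dist_eq_dist_add_one_of_adj c h with h2 | h2
    · rw [xor_comm, Sym2.eq_swap]
      exact hpre_child y x h.symm h2 e
    · exact hpre_child x y h h2 e
  intro a b W hW hne q hq
  have hreal : ∀ x, 0 < G.dist c x → ∃ e ∈ G.edgeFinset, vleg (far e) = vleg x ∧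
      G.dist c (far e) = G.dist c x := fun x hx => hedge x ((hpos x).2 hx)
  refine isLegDemand_of_xor (hreal a) (hreal b) ?_ fun e =>
    (hq e).trans (mem_edges_iff_xor hpre_adj W hW.isTrail e)
  obtain ⟨e, he⟩ := List.exists_mem_of_ne_nil _ hne
  exact ⟨e, (hq e).2 he⟩

end Graph

end Tollbooth

/-- For every tollbooth instance on a spider graph, there exists an item
pricing `p` such that for every arrival order `σ` there is a tie-breaking choice `t` with
`Wel(p,σ,t) ≥ (2/3)·OPT`. -/
theorem spider_gap_le_three_halves {V : Type*} [Fintype V] [DecidableEq V]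
    (G : SimpleGraph V) (hG : Tollbooth.IsSpider G)
    {n : ℕ} (Q : Fin n → Finset (Sym2 V)) (v : Fin n → ℝ≥0)
    (hI : Tollbooth.Instance G Q v) :
    ∃ p : Sym2 V → ℝ≥0∞, ∀ σ : Equiv.Perm (Fin n), ∃ t : Fin n → Bool,
      (2 / 3 : ℝ≥0) * Tollbooth.OPT Q v ≤ Tollbooth.Wel G p Q v σ t := by
  obtain ⟨htree, hsub⟩ := hG
  obtain ⟨c, hc⟩ : ∃ c : V, ∀ x, x ≠ c → G.degree x ≤ 2 := by
    by_cases h : ∃ c, 3 ≤ G.degree c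
    · obtain ⟨c, hc⟩ := h
      refine ⟨c, fun x hx => ?_⟩
      by_contra hlt
      exact hx (hsub (show 3 ≤ G.degree x by omega) hc)
    · obtain ⟨c⟩ := htree.connected.nonempty
      refine ⟨c, fun x _ => ?_⟩
      by_contra hlt
      exact h ⟨x, by omega⟩
  obtain ⟨leg, dep, hdep, hinj, hdown, hpath⟩ := Tollbooth.exists_leg_coordinates htree
    (c := c) fun x hx => by convert hc x hx
  have hne : ∀ j, (Q j).Nonempty := fun j => by
    obtain ⟨a, b, W, -, hW, hQ⟩ := (hI.2 j).2
    obtain ⟨e, he⟩ := List.exists_mem_of_ne_nil _ hW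
    exact ⟨e, by rw [hQ]; exact List.mem_toFinset.2 he⟩
  have hQG : ∀ j, Q j ⊆ G.edgeFinset := fun j e he => by
    obtain ⟨a, b, W, -, -, hQ⟩ := (hI.2 j).2
    rw [hQ, List.mem_toFinset] at he
    exact SimpleGraph.mem_edgeFinset.2 (W.edges_subset_edgeSet he)
  obtain ⟨p, hp0, hpv, S, hS, htight, hopt⟩ := Tollbooth.exists_tight_prices (v := v) hdep hinj
    hdown hne fun j => by
      obtain ⟨a, b, W, hW, hW', hQ⟩ := (hI.2 j).2
      exact hpath a b W hW hW' (Q j) fun e => by rw [hQ, List.mem_toFinset]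
  have hprice : ∀ j, Tollbooth.price (fun e => ENNReal.ofReal (p e)) (Q j) =
      ENNReal.ofReal (∑ e ∈ Q j, p e) := fun j =>
    (ENNReal.ofReal_sum_of_nonneg fun e _ => hp0 e).symm
  refine ⟨fun e => ENNReal.ofReal (p e), fun σ => ⟨fun j => decide (j ∈ S), ?_⟩⟩
  refine le_trans ?_ (Tollbooth.sum_le_Wel G (fun e => ENNReal.ofReal (p e)) Q v S hS hQG
    (fun j => ?_) (fun j hj => ?_) σ)
  · obtain ⟨S', hS', h⟩ := Finset.exists_mem_eq_sup
      (Finset.univ.powerset.filter fun S : Finset (Fin n) =>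
        (S : Set (Fin n)).Pairwise fun j k => Disjoint (Q j) (Q k))
      ⟨∅, by simp⟩ fun S => ∑ j ∈ S, v j
    rw [Tollbooth.OPT, h, ← NNReal.coe_le_coe]
    push_cast
    exact hopt S' (Finset.mem_filter.1 hS').2
  · rw [hprice, ← ENNReal.ofReal_coe_nnreal]
    exact ENNReal.ofReal_le_ofReal (hpv j)
  · rw [hprice, htight j hj, ENNReal.ofReal_coe_nnreal]
end
end

section
/- For every tollbooth instance on a tree, there exists an item pricing p such that for every arrival order σ there is a tie-breaking choice t with Wel(p,σ,t) ≥ OPT/3. (The competitive ratio of item pricing with seller tie-breaking power on trees is at most 3.) -/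
open scoped Classical NNReal ENNReal

noncomputable section

/-- Strong duality for fractional set packing: there are a fractional packing `y` and prices `p`
covering every value such that the total price equals the total value of the packing. -/
theorem exists_packing_prices {ι κ : Type*} [Fintype ι] [Fintype κ] [Nonempty κ]
    (Q : κ → Finset ι) (hQ : ∀ j, (Q j).Nonempty) (v : κ → ℝ) (hv : ∀ j, 0 < v j) :
    ∃ (p : ι → ℝ) (y : κ → ℝ), (∀ e, 0 ≤ p e) ∧ (∀ j, 0 ≤ y j) ∧
      (∀ j, v j ≤ ∑ e ∈ Q j, p e) ∧ (∀ e, ∑ j with e ∈ Q j, y j ≤ 1) ∧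
      ∑ e, p e = ∑ j, v j * y j := by
  have j₀ : κ := Classical.arbitrary κ
  obtain ⟨e₀, -⟩ := hQ j₀
  let f : (κ → ℝ) → (ι → ℝ) → ℝ := fun z q => ∑ j, z j / v j * ∑ e ∈ Q j, q e
  have hf_comm (z q) : f z q = ∑ e, q e * ∑ j with e ∈ Q j, z j / v j := by
    simp only [f, Finset.mul_sum, Finset.sum_filter]
    rw [Finset.sum_comm]
    refine Finset.sum_congr rfl fun j _ => ?_
    simp [mul_comm]
  obtain ⟨a, ha, b, hb, hab⟩ := Sion.exists_isSaddlePointOn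
    (X := stdSimplex ℝ κ) (Y := stdSimplex ℝ ι) (f := f)
    ⟨_, single_mem_stdSimplex ℝ j₀⟩ (convex_stdSimplex ℝ κ) (isCompact_stdSimplex ℝ κ)
    (fun q _ => (Continuous.lowerSemicontinuous (by fun_prop)).lowerSemicontinuousOn _)
    (fun q _ => ConvexOn.quasiconvexOn ⟨convex_stdSimplex ℝ κ, fun x _ y _ s t _ _ _ => le_of_eq (by
      simp only [f, Pi.add_apply, Pi.smul_apply, smul_eq_mul, Finset.mul_sum (s := Finset.univ),
        ← Finset.sum_add_distrib]
      exact Finset.sum_congr rfl fun j _ => by ring)⟩)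
    (convex_stdSimplex ℝ ι) ⟨_, single_mem_stdSimplex ℝ e₀⟩ (isCompact_stdSimplex ℝ ι)
    (fun z _ => (Continuous.upperSemicontinuous (by fun_prop)).upperSemicontinuousOn _)
    (fun z _ => ConcaveOn.quasiconcaveOn ⟨convex_stdSimplex ℝ ι, fun x _ y _ s t _ _ _ => le_of_eq (by
      simp only [hf_comm, Pi.add_apply, Pi.smul_apply, smul_eq_mul,
        Finset.mul_sum (s := Finset.univ), ← Finset.sum_add_distrib]
      exact Finset.sum_congr rfl fun j _ => by ring)⟩)
  have hcol (e : ι) : ∑ j with e ∈ Q j, a j / v j ≤ f a b := by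
    have h := hab a ha _ (single_mem_stdSimplex ℝ e)
    rw [hf_comm] at h
    simpa [Pi.single_apply] using h
  have hrow (j : κ) : f a b ≤ (∑ e ∈ Q j, b e) / v j := by
    have h := hab _ (single_mem_stdSimplex ℝ j) b hb
    simpa [f, Pi.single_apply, div_eq_mul_inv, mul_comm] using h
  have hpos : 0 < f a b := by
    obtain ⟨j, -, hj⟩ : ∃ j ∈ Finset.univ, 0 < a j := by
      refine Finset.exists_lt_of_sum_lt (f := fun _ => (0 : ℝ)) ?_
      simp [ha.2]
    obtain ⟨e, he⟩ := hQ j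
    refine (div_pos hj (hv j)).trans_le (le_trans ?_ (hcol e))
    exact Finset.single_le_sum (f := fun j => a j / v j)
      (fun i _ => div_nonneg (ha.1 i) (hv i).le) (by simp [he])
  refine ⟨fun e => b e / f a b, fun j => a j / v j / f a b,
    fun e => div_nonneg (hb.1 e) hpos.le,
    fun j => div_nonneg (div_nonneg (ha.1 j) (hv j).le) hpos.le, fun j => ?_, fun e => ?_, ?_⟩
  · rw [← Finset.sum_div, le_div_iff₀ hpos, mul_comm]
    exact (le_div_iff₀ (hv j)).1 (hrow j)
  · rw [← Finset.sum_div]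
    exact (div_le_one hpos).2 (hcol e)
  · have h (j : κ) : v j * (a j / v j / f a b) = a j / f a b := by
      have := (hv j).ne'
      field_simp
    simp only [h, ← Finset.sum_div, ha.2, hb.2]

/-- Complementary slackness: if prices `p` covering every value and a fractional packing `y` have
the same total, then every set in the support of `y` is priced at exactly its value. -/
theorem sum_eq_of_packing_prices {ι κ : Type*} [Fintype ι] [Fintype κ]
    (Q : κ → Finset ι) (v : κ → ℝ) (p : ι → ℝ) (y : κ → ℝ) (hp0 : ∀ e, 0 ≤ p e)
    (hy0 : ∀ j, 0 ≤ y j) (hp : ∀ j, v j ≤ ∑ e ∈ Q j, p e)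
    (hy : ∀ e, ∑ j with e ∈ Q j, y j ≤ 1) (hpy : ∑ e, p e = ∑ j, v j * y j)
    (j : κ) (hj : 0 < y j) : ∑ e ∈ Q j, p e = v j := by
  have hcomm : ∑ k, y k * ∑ e ∈ Q k, p e = ∑ e, p e * ∑ k with e ∈ Q k, y k := by
    simp only [Finset.mul_sum, Finset.sum_filter]
    rw [Finset.sum_comm]
    exact Finset.sum_congr rfl fun k _ => by simp [mul_comm]
  have hle : ∑ k, y k * ∑ e ∈ Q k, p e ≤ ∑ k, y k * v k := by
    rw [hcomm]
    calc ∑ e, p e * ∑ k with e ∈ Q k, y k ≤ ∑ e, p e :=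
          Finset.sum_le_sum fun e _ => mul_le_of_le_one_right (hp0 e) (hy e)
      _ = ∑ k, y k * v k := by simp only [hpy, mul_comm]
  by_contra hne
  exact hle.not_gt (Finset.sum_lt_sum (fun k _ => mul_le_mul_of_nonneg_left (hp k) (hy0 k))
    ⟨j, Finset.mem_univ j, mul_lt_mul_of_pos_left ((hp j).lt_of_ne' hne) hj⟩)

/-- Local-ratio rounding. If the sets `Q j` can be ranked so that the sets of rank at most that
of `j` which meet `Q j` are all hit by two elements, then a fractional packing `y` can be rounded
to a packing supported on `y` losing at most a factor of two. -/
theorem exists_packing_of_fractional {ι κ : Type*} [Fintype κ]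
    (Q : κ → Finset ι) (hQ : ∀ j, (Q j).Nonempty) (d : κ → ℕ) (e₁ e₂ : κ → ι)
    (hd : ∀ j k, d k ≤ d j → ¬ Disjoint (Q k) (Q j) → e₁ j ∈ Q k ∨ e₂ j ∈ Q k)
    (y : κ → ℝ) (hy : ∀ j, 0 ≤ y j) (hy1 : ∀ e, ∑ j with e ∈ Q j, y j ≤ 1) (w : κ → ℝ) :
    ∃ S : Finset κ, (∀ j ∈ S, 0 < y j ∧ 0 < w j) ∧
      (S : Set κ).Pairwise (fun j k => Disjoint (Q j) (Q k)) ∧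
      ∑ j, w j * y j ≤ 2 * ∑ j ∈ S, w j := by
  induction hm : (Finset.univ.filter fun j => 0 < y j ∧ 0 < w j).card using Nat.strong_induction_on
    generalizing w with
  | _ m ih =>
  set P := Finset.univ.filter fun j => 0 < y j ∧ 0 < w j with hP
  obtain hPe | hPn := P.eq_empty_or_nonempty
  · refine ⟨∅, by simp, by simp, ?_⟩
    rw [Finset.sum_empty, mul_zero]
    refine Finset.sum_nonpos fun j _ => ?_
    by_contra! h
    have hyj : 0 < y j := (hy j).lt_of_ne fun h0 => by simp [← h0] at h
    have : j ∈ P := by simpa [hP] using ⟨hyj, pos_of_mul_pos_left h hyj.le⟩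
    simp [hPe] at this
  obtain ⟨j, hj, hmax⟩ := P.exists_max_image d hPn
  have hjP := (Finset.mem_filter.1 hj).2
  set N := P.filter fun k => ¬ Disjoint (Q k) (Q j) with hN
  have hjN : j ∈ N := Finset.mem_filter.2 ⟨hj, by simpa using (hQ j).ne_empty⟩
  let w' : κ → ℝ := fun k => w k - if k ∈ N then w j else 0
  have hw' (k) : w' k ≤ w k := by
    simp only [w']; split_ifs <;> linarith [hjP.2]
  have hw'j : w' j = 0 := by simp [w', hjN]
  obtain ⟨S, hS, hSd, hSw⟩ := ih _ (by
    rw [← hm]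
    refine Finset.card_lt_card (Finset.ssubset_iff_of_subset ?_ |>.2 ⟨j, hj, by simp [hw'j]⟩)
    exact Finset.monotone_filter_right _ fun k _ hk => ⟨hk.1, hk.2.trans_le (hw' k)⟩) w' rfl
  have hsum (T : Finset κ) : ∑ k ∈ T, w k = ∑ k ∈ T, w' k + (T ∩ N).card * w j := by
    simp [w', Finset.sum_ite_mem]
  have hfrac : ∑ k, w k * y k ≤ ∑ k, w' k * y k + 2 * w j := by
    have h1 : ∑ k ∈ N, y k ≤ 2 := by
      calc ∑ k ∈ N, y k ≤ ∑ k ∈ (Finset.univ.filter fun k => e₁ j ∈ Q k) ∪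
            (Finset.univ.filter fun k => e₂ j ∈ Q k), y k := by
            refine Finset.sum_le_sum_of_subset_of_nonneg (fun k hk => ?_) fun k _ _ => hy k
            obtain ⟨hkP, hkj⟩ := Finset.mem_filter.1 hk
            simpa using hd j k (hmax k hkP) hkj
        _ ≤ (∑ k with e₁ j ∈ Q k, y k) + ∑ k with e₂ j ∈ Q k, y k := by
            rw [← Finset.sum_union_inter]
            exact le_add_of_nonneg_right (Finset.sum_nonneg fun k _ => hy k)
        _ ≤ 2 := by linarith [hy1 (e₁ j), hy1 (e₂ j)]
    have h2 : ∑ k, w k * y k = ∑ k, w' k * y k + w j * ∑ k ∈ N, y k := by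
      simp [w', sub_mul, Finset.mul_sum]
    nlinarith [hjP.2]
  have hSP (k) (hk : k ∈ S) : k ∈ P :=
    Finset.mem_filter.2 ⟨Finset.mem_univ _, (hS k hk).1, (hS k hk).2.trans_le (hw' k)⟩
  obtain hSN | hSN := (S ∩ N).eq_empty_or_nonempty
  · have hdis (k) (hk : k ∈ S) : Disjoint (Q k) (Q j) := by
      by_contra h
      have : k ∈ S ∩ N := Finset.mem_inter.2 ⟨hk, Finset.mem_filter.2 ⟨hSP k hk, h⟩⟩
      simp [hSN] at this
    have hjS : j ∉ S := fun h => by simpa [hw'j] using (hS j h).2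
    refine ⟨insert j S, fun k hk => ?_, ?_, ?_⟩
    · rcases Finset.mem_insert.1 hk with rfl | hk
      exacts [hjP, (Finset.mem_filter.1 (hSP k hk)).2]
    · rw [Finset.coe_insert]
      exact hSd.insert fun k hk _ => ⟨(hdis k hk).symm, hdis k hk⟩
    · rw [Finset.sum_insert hjS, hsum S, hSN]
      simp only [Finset.card_empty, Nat.cast_zero, zero_mul, add_zero]
      linarith
  · refine ⟨S, fun k hk => (Finset.mem_filter.1 (hSP k hk)).2, hSd, ?_⟩
    rw [hsum S]
    have : (1 : ℝ) ≤ (S ∩ N).card := by exact_mod_cast hSN.card_pos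
    nlinarith [hjP.2]

/-- In a tree, if `u` is the vertex closest to `r` on a trail starting at `u`, then the first edge
of the trail lies on every walk that shares an edge with the trail and reaches a vertex at most
as far from `r` as `u`. -/
theorem SimpleGraph.IsTree.exists_edge_of_trail {V : Type*} {G : SimpleGraph V} (hG : G.IsTree)
    (r : V) {u b : V} (W : G.Walk u b) (hW : W.IsTrail)
    (hu : ∀ c ∈ W.support, G.dist r u ≤ G.dist r c) :
    ∃ e, ∀ {x y : V} (P : G.Walk x y), ∀ z ∈ P.support, G.dist r z ≤ G.dist r u →
      ∀ f ∈ P.edges, f ∈ W.edges → e ∈ P.edges := by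
  cases W with
  | nil => exact ⟨s(r, r), by simp⟩
  | @cons _ c _ huc W =>
  rw [SimpleGraph.Walk.isTrail_cons] at hW
  refine ⟨s(u, c), fun {x y} P z hz hzu f hfP hfW => ?_⟩
  by_contra he
  have hbr := (SimpleGraph.isAcyclic_iff_forall_adj_isBridge.1 hG.isAcyclic huc)
  rw [SimpleGraph.isBridge_iff] at hbr
  have hreach {x y : V} (P : G.Walk x y) (h : s(u, c) ∉ P.edges) :
      (G.deleteEdges {s(u, c)}).Reachable x y :=
    SimpleGraph.reachable_deleteEdges_iff_exists_walk.2 ⟨P, h⟩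
  have hsupp {x y z : V} (P : G.Walk x y) (h : s(u, c) ∉ P.edges) (hz : z ∈ P.support) :
      (G.deleteEdges {s(u, c)}).Reachable x z :=
    hreach (P.takeUntil z hz) fun h' => h (P.edges_takeUntil_subset_edges hz h')
  have hfW' : f ∈ W.edges := by
    rcases List.mem_cons.1 hfW with rfl | h
    exacts [(he hfP).elim, h]
  have hfar (x : V) (hx : (G.deleteEdges {s(u, c)}).Reachable c x) :
      G.dist r u < G.dist r x := by
    have hr : ¬ (G.deleteEdges {s(u, c)}).Reachable c r := by
      intro hr
      obtain ⟨R, hR⟩ := hG.connected.exists_walk_length_eq_dist r u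
      have hmem : s(u, c) ∈ R.edges := by
        by_contra h
        exact hbr (hr.trans (hreach R h)).symm
      have hc := R.snd_mem_support_of_mem_edges hmem
      have h1 := R.length_takeUntil_lt_length hc huc.ne'
      have h2 := SimpleGraph.dist_le (R.takeUntil c hc)
      have h3 := hu c (by simp)
      omega
    obtain ⟨R, hR⟩ := hG.connected.exists_walk_length_eq_dist r x
    have hmem : s(u, c) ∈ R.edges := by
      by_contra h
      exact hr (hx.trans (hreach R h).symm)
    have hu := R.fst_mem_support_of_mem_edges hmem
    have h1 := R.length_takeUntil_lt_length hu (by rintro rfl; exact hbr hx.symm)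
    have h2 := SimpleGraph.dist_le (R.takeUntil u hu)
    omega
  induction f with
  | _ s t =>
  have hs := hsupp W hW.2 (W.fst_mem_support_of_mem_edges hfW')
  have hxs := hsupp P he (P.fst_mem_support_of_mem_edges hfP)
  have hxz := hsupp P he hz
  exact absurd (hfar z (hs.trans (hxs.symm.trans hxz))) (not_lt.2 hzu)

/-- The edge sets of paths in a tree can be ranked so that those of rank at most that of `j`
which meet `Q j` are all hit by two edges. -/
theorem SimpleGraph.IsTree.exists_rank_of_paths {V κ : Type*} {G : SimpleGraph V} (hG : G.IsTree)
    (Q : κ → Finset (Sym2 V))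
    (hQ : ∀ j, ∃ (a b : V) (W : G.Walk a b), W.IsPath ∧ ∀ e, e ∈ Q j ↔ e ∈ W.edges) :
    ∃ (d : κ → ℕ) (e₁ e₂ : κ → Sym2 V), ∀ j k, d k ≤ d j → ¬ Disjoint (Q k) (Q j) →
      e₁ j ∈ Q k ∨ e₂ j ∈ Q k := by
  obtain ⟨r⟩ := hG.connected.nonempty
  choose a b W hW hQW using hQ
  have hmin (j) : ∃ u ∈ (W j).support, ∀ c ∈ (W j).support, G.dist r u ≤ G.dist r c := by
    obtain ⟨u, hu, h⟩ := (W j).support.toFinset.exists_min_image (G.dist r) ⟨a j, by simp⟩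
    exact ⟨u, by simpa using hu, fun c hc => h c (by simpa using hc)⟩
  choose u hu hmin using hmin
  choose e₁ he₁ using fun j => hG.exists_edge_of_trail r ((W j).takeUntil (u j) (hu j)).reverse
    ((hW j).isTrail.takeUntil (hu j)).reverse fun c hc => hmin j c
      ((W j).support_takeUntil_subset_support (hu j) (by simpa using hc))
  choose e₂ he₂ using fun j => hG.exists_edge_of_trail r ((W j).dropUntil (u j) (hu j))
    ((hW j).isTrail.dropUntil (hu j)) fun c hc => hmin j c
      ((W j).support_dropUntil_subset_support (hu j) hc)
  refine ⟨fun j => G.dist r (u j), e₁, e₂, fun j k hd hjk => ?_⟩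
  obtain ⟨f, hfk, hfj⟩ := Finset.not_disjoint_iff.1 hjk
  rw [hQW] at hfk hfj
  rw [hQW k, hQW k]
  rw [← (W j).take_spec (hu j), SimpleGraph.Walk.edges_append, List.mem_append] at hfj
  exact hfj.imp (fun h => he₁ j (W k) _ (hu k) hd f hfk (by simpa using h))
    (fun h => he₂ j (W k) _ (hu k) hd f hfk h)

/-- If nobody has positive surplus, every buyer of an edge-disjoint family `S` of buyers with zero
surplus purchases when ties are broken in favour of exactly the members of `S`. -/
theorem Tollbooth.subset_purchased {V : Type*} [Fintype V] [DecidableEq V] {n : ℕ}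
    (G : SimpleGraph V) (p : Sym2 V → ℝ≥0∞) (Q : Fin n → Finset (Sym2 V)) (v : Fin n → ℝ≥0)
    (hQG : ∀ j, Q j ⊆ G.edgeFinset) (hp : ∀ j, (v j : ℝ≥0∞) ≤ Tollbooth.price p (Q j))
    (S : Finset (Fin n)) (hS : ∀ j ∈ S, Tollbooth.price p (Q j) = v j)
    (hSd : (S : Set (Fin n)).Pairwise fun j k => Disjoint (Q j) (Q k))
    (σ : Equiv.Perm (Fin n)) :
    S ⊆ Tollbooth.purchased G p Q v σ (fun j => decide (j ∈ S)) := by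
  have key (l : List (Fin n)) (hl : l.Nodup) (st : Finset (Sym2 V) × Finset (Fin n))
      (hst : ∀ j ∈ l, j ∈ S → Q j ⊆ st.1) (j : Fin n) (hj : j ∈ S) (hjl : j ∈ l ∨ j ∈ st.2) :
      j ∈ (l.foldl (Tollbooth.step p Q v fun j => decide (j ∈ S)) st).2 := by
    induction l generalizing st with
    | nil => simpa using hjl
    | cons i l ih =>
      rw [List.nodup_cons] at hl
      rw [List.foldl_cons]
      by_cases hi : i ∈ S
      · have hstep : Tollbooth.step p Q v (fun j => decide (j ∈ S)) st i =
            (st.1 \ Q i, insert i st.2) :=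
          if_pos ⟨hst i List.mem_cons_self hi, Or.inr ⟨hS i hi, by simpa using hi⟩⟩
        rw [hstep]
        refine ih hl.2 _ (fun k hk hkS => ?_) ?_
        · exact Finset.subset_sdiff.2 ⟨hst k (List.mem_cons_of_mem _ hk) hkS,
            hSd hkS hi (by rintro rfl; exact hl.1 hk)⟩
        · simp only [List.mem_cons, Finset.mem_insert] at hjl ⊢
          tauto
      · have hstep : Tollbooth.step p Q v (fun j => decide (j ∈ S)) st i = st :=
          if_neg fun h => h.2.elim (fun h => absurd h (hp i).not_gt) fun h => hi (by simpa using h.2)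
        rw [hstep]
        refine ih hl.2 _ (fun k hk => hst k (List.mem_cons_of_mem _ hk)) ?_
        have hji : j ≠ i := by
          rintro rfl
          exact hi hj
        simpa [hji] using hjl
  intro j hj
  refine key _ (List.nodup_ofFn.2 σ.injective) _ (fun k _ _ => hQG k) j hj (Or.inl ?_)
  exact (List.mem_ofFn).2 ⟨σ.symm j, by simp⟩

/-- Weak duality: prices covering every value bound the optimal welfare. -/
theorem Tollbooth.OPT_le_sum {V : Type*} [Fintype V] [DecidableEq V] {n : ℕ}
    (Q : Fin n → Finset (Sym2 V)) (v : Fin n → ℝ≥0) (p : Sym2 V → ℝ) (hp0 : ∀ e, 0 ≤ p e)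
    (hp : ∀ j, (v j : ℝ) ≤ ∑ e ∈ Q j, p e) : (Tollbooth.OPT Q v : ℝ) ≤ ∑ e, p e := by
  have hnn : 0 ≤ ∑ e, p e := Finset.sum_nonneg fun e _ => hp0 e
  rw [← Real.le_toNNReal_iff_coe_le hnn]
  refine Finset.sup_le fun S hS => ?_
  rw [Real.le_toNNReal_iff_coe_le hnn, NNReal.coe_sum]
  refine (Finset.sum_le_sum fun j _ => hp j).trans ?_
  rw [← Finset.sum_biUnion (Finset.mem_filter.1 hS).2]
  exact Finset.sum_le_sum_of_subset_of_nonneg (Finset.subset_univ _) fun e _ _ => hp0 e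

/-- For every tollbooth instance on a tree, there exists an item pricing `p`
such that for every arrival order `σ` there is a tie-breaking choice `t` with
`Wel(p,σ,t) ≥ OPT/3`. -/
theorem tree_gap_le_three {V : Type*} [Fintype V] [DecidableEq V]
    (G : SimpleGraph V) (hG : G.IsTree)
    {n : ℕ} (Q : Fin n → Finset (Sym2 V)) (v : Fin n → ℝ≥0)
    (hI : Tollbooth.Instance G Q v) :
    ∃ p : Sym2 V → ℝ≥0∞, ∀ σ : Equiv.Perm (Fin n), ∃ t : Fin n → Bool,
      Tollbooth.OPT Q v / 3 ≤ Tollbooth.Wel G p Q v σ t := by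
  obtain ⟨hn, hI⟩ := hI
  have : Nonempty (Fin n) := ⟨⟨0, hn⟩⟩
  have hQ (j) : (Q j).Nonempty := by
    obtain ⟨a, b, W, -, hW, hQW⟩ := (hI j).2
    rw [hQW, List.toFinset_nonempty_iff]
    exact hW
  have hQG (j) : Q j ⊆ G.edgeFinset := by
    obtain ⟨a, b, W, -, -, hQW⟩ := (hI j).2
    intro e he
    rw [hQW, List.mem_toFinset] at he
    exact SimpleGraph.mem_edgeFinset.2 (W.edges_subset_edgeSet he)
  obtain ⟨p, y, hp0, hy0, hp, hy, hpy⟩ := exists_packing_prices Q hQ (fun j => (v j : ℝ))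
    fun j => (hI j).1
  have hslack := sum_eq_of_packing_prices Q (fun j => (v j : ℝ)) p y hp0 hy0 hp hy hpy
  obtain ⟨d, e₁, e₂, hd⟩ := hG.exists_rank_of_paths Q fun j => by
    obtain ⟨a, b, W, hW, -, hQW⟩ := (hI j).2
    exact ⟨a, b, W, hW, by simp [hQW]⟩
  obtain ⟨S, hS, hSd, hSw⟩ := exists_packing_of_fractional Q hQ d e₁ e₂ hd y hy0 hy
    fun j => (v j : ℝ)
  have hprice (j) : Tollbooth.price (fun e => ENNReal.ofReal (p e)) (Q j) =
      ENNReal.ofReal (∑ e ∈ Q j, p e) :=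
    (ENNReal.ofReal_sum_of_nonneg fun e _ => hp0 e).symm
  refine ⟨fun e => ENNReal.ofReal (p e), fun σ => ⟨fun j => decide (j ∈ S), ?_⟩⟩
  have hsub := Tollbooth.subset_purchased G (fun e => ENNReal.ofReal (p e)) Q v hQG
    (fun j => by
      rw [hprice, ← ENNReal.ofReal_coe_nnreal]
      exact ENNReal.ofReal_le_ofReal (hp j)) S
    (fun j hj => by rw [hprice, hslack j (hS j hj).1, ENNReal.ofReal_coe_nnreal]) hSd σ
  have hWel : ∑ j ∈ S, v j ≤ Tollbooth.Wel G (fun e => ENNReal.ofReal (p e)) Q v σ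
      (fun j => decide (j ∈ S)) := Finset.sum_le_sum_of_subset hsub
  refine le_trans ?_ hWel
  rw [← NNReal.coe_le_coe]
  push_cast
  have hopt := Tollbooth.OPT_le_sum Q v p hp0 hp
  have hnn : (0 : ℝ) ≤ ∑ j ∈ S, (v j : ℝ) := Finset.sum_nonneg fun j _ => (v j).2
  linarith
end
end

section
/- For every tollbooth instance on a path graph, there exists an item pricing p such that for every arrival order σ and every tie-breaking choice t, Wel(p,σ,t) ≥ (2/3)·OPT. (When the seller has no tie-breaking power, the competitive ratio of item pricing on paths is at most 3/2.) -/
open scoped Classical NNReal ENNReal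

noncomputable section

namespace Tollbooth

section Line

variable {n : ℕ} (l r : Fin n → ℕ) (v : Fin n → ℝ≥0)

/-- The largest value of a buyer demanding the interval `[x, y)`. -/
def bestValue (x y : ℕ) : ℝ≥0 := (Finset.univ.filter fun j => l j = x ∧ r j = y).sup v

/-- The largest total value of a packing of demand intervals inside `[0, y)`. -/
def packingValue : ℕ → ℝ≥0
  | y => (Finset.univ : Finset (Fin y)).sup fun x => packingValue x + bestValue l r v x y
decreasing_by exact x.2

/-- `[x, y)` is either the demand of a buyer whose value is the increment of `P`, or a single
edge along which `P` does not increase. -/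
def TightArc (P : ℕ → ℝ) (x y : ℕ) : Prop :=
  x < y ∧ ((∃ j, l j = x ∧ r j = y ∧ P x + v j = P y) ∨ (y = x + 1 ∧ P x = P y))

theorem packingValue_add_le {x y : ℕ} (h : x < y) :
    packingValue l r v x + bestValue l r v x y ≤ packingValue l r v y := by
  conv_rhs => rw [packingValue]
  exact Finset.le_sup (f := fun x : Fin y => packingValue l r v x + bestValue l r v x y)
    (Finset.mem_univ (⟨x, h⟩ : Fin y))

theorem packingValue_mono : Monotone (packingValue l r v) := by
  intro x y h
  rcases h.eq_or_lt with rfl | h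
  · exact le_rfl
  · exact le_self_add.trans (packingValue_add_le l r v h)

theorem exists_packingValue_eq {y : ℕ} (hy : 0 < y) :
    ∃ x < y, packingValue l r v y = packingValue l r v x + bestValue l r v x y := by
  have : Nonempty (Fin y) := ⟨⟨0, hy⟩⟩
  obtain ⟨x, -, hx⟩ := Finset.exists_mem_eq_sup (Finset.univ : Finset (Fin y))
    Finset.univ_nonempty fun x => packingValue l r v x + bestValue l r v x y
  refine ⟨x, x.2, ?_⟩
  rw [← hx, packingValue]

theorem exists_potential (hlr : ∀ j, l j < r j) :
    ∃ P : ℕ → ℝ, P 0 = 0 ∧ Monotone P ∧ (∀ j, P (l j) + v j ≤ P (r j)) ∧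
      ∀ y, 0 < y → ∃ x, TightArc l r v P x y := by
  refine ⟨fun y => packingValue l r v y, ?_, ?_, ?_, ?_⟩
  · have h : packingValue l r v 0 = 0 := by rw [packingValue]; simp
    simp [h]
  · intro x y h
    exact_mod_cast packingValue_mono l r v h
  · intro j
    have h := packingValue_add_le l r v (hlr j)
    have h' : v j ≤ bestValue l r v (l j) (r j) :=
      Finset.le_sup (f := v) (by simp)
    exact_mod_cast (by gcongr : packingValue l r v (l j) + v j ≤ _).trans h
  · intro y hy
    obtain ⟨x, hxy, hx⟩ := exists_packingValue_eq l r v hy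
    rcases Finset.eq_empty_or_nonempty (Finset.univ.filter fun j => l j = x ∧ r j = y) with h | h
    · have hxy' : packingValue l r v y = packingValue l r v x := by
        rw [hx, bestValue, h]; simp
      refine ⟨y - 1, by omega, Or.inr ⟨by omega, ?_⟩⟩
      have h1 := packingValue_mono l r v (show x ≤ y - 1 by omega)
      have h2 := packingValue_mono l r v (show y - 1 ≤ y by omega)
      exact congrArg NNReal.toReal (le_antisymm h2 (hxy' ▸ h1))
    · obtain ⟨j, hj, hjv⟩ := Finset.exists_mem_eq_sup _ h v
      simp only [Finset.mem_filter, Finset.mem_univ, true_and] at hj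
      refine ⟨x, hxy, Or.inl ⟨j, hj.1, hj.2, ?_⟩⟩
      simp only [hx, bestValue, hjv, NNReal.coe_add]

/-- The maximal number of arcs of `T` on a chain ending in `y`. -/
def depth (T : ℕ → ℕ → Prop) : ℕ → ℕ
  | y => (Finset.univ : Finset (Fin y)).sup fun x => if T x y then depth T x + 1 else 0
decreasing_by exact x.2

theorem depth_lt_depth {T : ℕ → ℕ → Prop} {x y : ℕ} (h : x < y) (hT : T x y) :
    depth T x + 1 ≤ depth T y := by
  conv_rhs => rw [depth]
  refine le_trans ?_ (Finset.le_sup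
    (f := fun x : Fin y => if T x y then depth T x + 1 else 0) (Finset.mem_univ ⟨x, h⟩))
  simp [hT]

theorem exists_depth_eq {T : ℕ → ℕ → Prop} {y : ℕ} (h : ∃ x < y, T x y) :
    ∃ x < y, T x y ∧ depth T x + 1 = depth T y := by
  obtain ⟨x₀, hx₀, hT₀⟩ := h
  have : Nonempty (Fin y) := ⟨⟨x₀, hx₀⟩⟩
  obtain ⟨x, -, hx⟩ := Finset.exists_mem_eq_sup (Finset.univ : Finset (Fin y))
    Finset.univ_nonempty fun x => if T x y then depth T x + 1 else 0
  have h1 := depth_lt_depth hx₀ hT₀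
  have hd : depth T y = if T x y then depth T x + 1 else 0 := by rw [← hx, depth]
  by_cases hT : T x y
  · exact ⟨x, x.2, hT, by rw [hd, if_pos hT]⟩
  · rw [if_neg hT] at hd; omega

/-- A chain of maximal length from `0` to `y`, choosing the leftmost predecessor each time. -/
theorem exists_leftmost_chain {T : ℕ → ℕ → Prop} (hlt : ∀ x y, T x y → x < y)
    (hpred : ∀ y, 0 < y → ∃ x, T x y) (y : ℕ) :
    ∃ s : ℕ → ℕ, s 0 = 0 ∧ s (depth T y) = y ∧
      (∀ i ≤ depth T y, depth T (s i) = i) ∧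
      ∀ i < depth T y, T (s i) (s (i + 1)) ∧
        ∀ z, T z (s (i + 1)) → depth T z = i → s i ≤ z := by
  induction y using Nat.strong_induction_on with
  | _ y ih =>
    rcases Nat.eq_zero_or_pos y with rfl | hy
    · have h0 : depth T 0 = 0 := by rw [depth]; simp
      refine ⟨fun _ => 0, rfl, rfl, ?_, ?_⟩
      · intro i hi; simp only [h0] at hi ⊢; omega
      · intro i hi; omega
    · have hex : ∃ x, T x y ∧ depth T x + 1 = depth T y := by
        obtain ⟨x, hx⟩ := hpred y hy
        obtain ⟨x, -, hx⟩ := exists_depth_eq ⟨x, hlt _ _ hx, hx⟩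
        exact ⟨x, hx⟩
      obtain ⟨hT, hd⟩ := Nat.find_spec hex
      have hmin : ∀ z, T z y → depth T z + 1 = depth T y → Nat.find hex ≤ z :=
        fun z h1 h2 => Nat.find_min' hex ⟨h1, h2⟩
      generalize Nat.find hex = x at hT hd hmin
      obtain ⟨s, hs0, hsx, hsd, hs⟩ := ih x (hlt _ _ hT)
      refine ⟨fun i => if i ≤ depth T x then s i else y, by simp [hs0], ?_, ?_, ?_⟩
      · simp [← hd]
      · intro i hi
        by_cases h : i ≤ depth T x
        · simp [h, hsd]
        · simp only [h, if_false]; omega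
      · intro i hi
        rcases Nat.lt_or_ge i (depth T x) with h | h
        · simpa [h.le, Nat.succ_le_of_lt h] using hs i h
        · have hi' : i = depth T x := by omega
          subst hi'
          simp only [le_refl, if_true, hsx, show ¬ depth T x + 1 ≤ depth T x by omega, if_false]
          exact ⟨hT, fun z h1 h2 => hmin z h1 (by omega)⟩

theorem sum_Ico_sub_eq (f : ℕ → ℝ) {a c : ℕ} (h : a ≤ c) :
    ∑ x ∈ Finset.Ico a c, (f (x + 1) - f x) = f c - f a := by
  induction c, h using Nat.le_induction with
  | base => simp
  | succ c h ih => rw [Finset.sum_Ico_succ_top h, ih]; ring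

/-- Some pricing `q` of the edges in `[a, c)` only ever sells, among the demands inside `[a, c)`,
to buyers whose value is the increment of `P`, and always sells a set `K` of edges along which
`P` increases by at least `w` in total. -/
def Secures (P : ℕ → ℝ) (a c : ℕ) (w : ℝ) : Prop :=
  ∃ (q : ℕ → ℝ≥0∞) (K : Finset ℕ), K ⊆ Finset.Ico a c ∧ w ≤ ∑ x ∈ K, (P (x + 1) - P x) ∧
    (∀ j, a ≤ l j → r j ≤ c → ∑ x ∈ Finset.Ico (l j) (r j), q x ≤ v j →
      P (l j) + v j = P (r j)) ∧
    ∀ x ∈ K, ∃ j, a ≤ l j ∧ r j ≤ c ∧ x ∈ Finset.Ico (l j) (r j) ∧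
      ∑ x ∈ Finset.Ico (l j) (r j), q x < v j ∧
      ∀ k, a ≤ l k → r k ≤ c → ∑ x ∈ Finset.Ico (l k) (r k), q x ≤ v k →
        ¬ Disjoint (Finset.Ico (l j) (r j)) (Finset.Ico (l k) (r k)) →
        Finset.Ico (l j) (r j) ⊆ Finset.Ico (l k) (r k)

variable {l r v} {P : ℕ → ℝ}

theorem secures_zero (hlr : ∀ j, l j < r j) (a c : ℕ) : Secures l r v P a c 0 := by
  refine ⟨fun _ => ⊤, ∅, by simp, by simp, ?_, by simp⟩
  intro j _ _ hj
  have : (Finset.Ico (l j) (r j)).card ≠ 0 := by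
    rw [Nat.card_Ico]; have := hlr j; omega
  rw [Finset.sum_const, nsmul_eq_mul, ENNReal.mul_top (by exact_mod_cast this)] at hj
  simp at hj

theorem Secures.append (hlr : ∀ j, l j < r j) {a c a' c' : ℕ} {w w' : ℝ} (hac : a ≤ c)
    (hac' : a' ≤ c') (h : Secures l r v P a c w) (hc : c < a') (h' : Secures l r v P a' c' w') :
    Secures l r v P a c' (w + w') := by
  obtain ⟨q, K, hK, hw, hq, hs⟩ := h
  obtain ⟨q', K', hK', hw', hq', hs'⟩ := h'
  set p : ℕ → ℝ≥0∞ := fun x => if x < c then q x else if x < a' then ⊤ else q' x with hp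
  have hleft : ∀ j, r j ≤ c → ∑ x ∈ Finset.Ico (l j) (r j), p x =
      ∑ x ∈ Finset.Ico (l j) (r j), q x := by
    intro j hj
    refine Finset.sum_congr rfl fun x hx => ?_
    rw [Finset.mem_Ico] at hx
    rw [hp]
    simp only [if_pos (show x < c by omega)]
  have hright : ∀ j, a' ≤ l j → ∑ x ∈ Finset.Ico (l j) (r j), p x =
      ∑ x ∈ Finset.Ico (l j) (r j), q' x := by
    intro j hj
    refine Finset.sum_congr rfl fun x hx => ?_
    rw [Finset.mem_Ico] at hx
    rw [hp]
    simp only [if_neg (show ¬ x < c by omega), if_neg (show ¬ x < a' by omega)]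
  have hside : ∀ j, ∑ x ∈ Finset.Ico (l j) (r j), p x ≤ v j → r j ≤ c ∨ a' ≤ l j := by
    intro j hj
    by_contra! hcon
    have hmem : max (l j) c ∈ Finset.Ico (l j) (r j) := by
      have := hlr j
      rw [Finset.mem_Ico]; omega
    have htop : p (max (l j) c) = ⊤ := by
      rw [hp]
      simp only [if_neg (show ¬ max (l j) c < c by omega), if_pos (show max (l j) c < a' by omega)]
    have := (Finset.single_le_sum (f := p) (fun _ _ => zero_le) hmem).trans hj
    rw [htop] at this
    simp at this
  have hdisj : Disjoint K K' := by
    rw [Finset.disjoint_left]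
    intro x hx hx'
    have h1 := Finset.mem_Ico.1 (hK hx)
    have h2 := Finset.mem_Ico.1 (hK' hx')
    omega
  refine ⟨p, K ∪ K', ?_, ?_, ?_, ?_⟩
  · intro x hx
    rw [Finset.mem_Ico]
    rcases Finset.mem_union.1 hx with hx | hx
    · have h1 := Finset.mem_Ico.1 (hK hx)
      omega
    · have h1 := Finset.mem_Ico.1 (hK' hx)
      omega
  · rw [Finset.sum_union hdisj]; linarith
  · intro j h1 h2 h3
    rcases hside j h3 with h | h
    · exact hq j h1 h (hleft j h ▸ h3)
    · exact hq' j h h2 (hright j h ▸ h3)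
  · intro x hx
    rcases Finset.mem_union.1 hx with hx | hx
    · obtain ⟨j, h1, h2, h3, h4, h5⟩ := hs x hx
      refine ⟨j, h1, ?_, h3, by rwa [hleft j h2], ?_⟩
      · omega
      intro k k1 k2 k3 k4
      rcases hside k k3 with h | h
      · exact h5 k k1 h (hleft k h ▸ k3) k4
      · refine absurd ?_ k4
        rw [Finset.disjoint_left]
        intro z hz hz'
        rw [Finset.mem_Ico] at hz hz'
        omega
    · obtain ⟨j, h1, h2, h3, h4, h5⟩ := hs' x hx
      refine ⟨j, ?_, h2, h3, by rwa [hright j h1], ?_⟩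
      · omega
      intro k k1 k2 k3 k4
      rcases hside k k3 with h | h
      · refine absurd ?_ k4
        rw [Finset.disjoint_left]
        intro z hz hz'
        rw [Finset.mem_Ico] at hz hz'
        omega
      · exact h5 k h k2 (hright k h ▸ k3) k4

theorem secures_of_tilt (hP : Monotone P) (hub : ∀ j, P (l j) + v j ≤ P (r j))
    (hlr : ∀ j, l j < r j) {a c : ℕ} (hac : a ≤ c) (φ : ℕ → ℝ)
    (hflat : ∀ x, a ≤ x → x < c → P x = P (x + 1) → φ x ≤ φ (x + 1))
    (hcover : ∀ x, a ≤ x → x < c → ∃ j, a ≤ l j ∧ r j ≤ c ∧ x ∈ Finset.Ico (l j) (r j) ∧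
      P (l j) + v j = P (r j) ∧ φ (r j) < φ (l j) ∧
      ∀ k, a ≤ l k → r k ≤ c → P (l k) + v k = P (r k) → φ (r k) ≤ φ (l k) →
        ¬ Disjoint (Finset.Ico (l j) (r j)) (Finset.Ico (l k) (r k)) →
        Finset.Ico (l j) (r j) ⊆ Finset.Ico (l k) (r k)) :
    Secures l r v P a c (P c - P a) := by
  have hev : ∀ A B : ℝ, 0 < A → ∀ᶠ ε in nhdsWithin (0 : ℝ) (Set.Ioi 0), 0 < A + ε * B := by
    intro A B hA
    have hc : ContinuousAt (fun ε : ℝ => A + ε * B) 0 := by fun_prop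
    have : ∀ᶠ ε in nhds (0 : ℝ), 0 < A + ε * B :=
      hc.eventually (lt_mem_nhds (by simpa using hA))
    exact this.filter_mono nhdsWithin_le_nhds
  have h1 : ∀ᶠ ε in nhdsWithin (0 : ℝ) (Set.Ioi 0), ∀ x ∈ Finset.Ico a c,
      0 ≤ (P (x + 1) - P x) + ε * (φ (x + 1) - φ x) := by
    rw [Filter.eventually_all_finset]
    intro x hx
    rw [Finset.mem_Ico] at hx
    rcases (hP (Nat.le_succ x)).eq_or_lt with h | h
    · filter_upwards [self_mem_nhdsWithin] with ε hε
      have h2 := hflat x hx.1 hx.2 h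
      have : 0 ≤ ε * (φ (x + 1) - φ x) := mul_nonneg (le_of_lt hε) (by linarith)
      simp only [Nat.succ_eq_add_one] at h
      linarith
    · filter_upwards [hev _ (φ (x + 1) - φ x) (sub_pos.2 h)] with ε hε
      exact hε.le
  have h2 : ∀ᶠ ε in nhdsWithin (0 : ℝ) (Set.Ioi 0), ∀ j,
      P (l j) + v j ≠ P (r j) → 0 < (P (r j) - P (l j) - v j) + ε * (φ (r j) - φ (l j)) := by
    rw [Filter.eventually_all]
    intro j
    by_cases h : P (l j) + v j = P (r j)
    · simp [h]
    · have := lt_of_le_of_ne (hub j) h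
      filter_upwards [hev _ (φ (r j) - φ (l j)) (show 0 < P (r j) - P (l j) - v j by linarith)]
        with ε hε _ using hε
  obtain ⟨ε, ⟨h1, h2⟩, hε⟩ := ((h1.and h2).and self_mem_nhdsWithin).exists
  have hε : 0 < ε := hε
  set q : ℕ → ℝ≥0∞ := fun x =>
    ENNReal.ofReal ((P (x + 1) - P x) + ε * (φ (x + 1) - φ x)) with hq
  have hsum : ∀ j, a ≤ l j → r j ≤ c → 0 ≤ P (r j) - P (l j) + ε * (φ (r j) - φ (l j)) ∧
      ∑ x ∈ Finset.Ico (l j) (r j), q x =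
        ENNReal.ofReal (P (r j) - P (l j) + ε * (φ (r j) - φ (l j))) := by
    intro j hj hj'
    have hnn : ∀ x ∈ Finset.Ico (l j) (r j),
        0 ≤ (P (x + 1) - P x) + ε * (φ (x + 1) - φ x) := by
      intro x hx
      rw [Finset.mem_Ico] at hx
      exact h1 x (Finset.mem_Ico.2 ⟨by omega, by omega⟩)
    have htel : ∑ x ∈ Finset.Ico (l j) (r j), ((P (x + 1) - P x) + ε * (φ (x + 1) - φ x)) =
        P (r j) - P (l j) + ε * (φ (r j) - φ (l j)) := by
      rw [Finset.sum_add_distrib, ← Finset.mul_sum, sum_Ico_sub_eq _ (hlr j).le,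
        sum_Ico_sub_eq _ (hlr j).le]
    rw [← htel, hq, ENNReal.ofReal_sum_of_nonneg hnn]
    exact ⟨Finset.sum_nonneg hnn, rfl⟩
  have hle : ∀ j, a ≤ l j → r j ≤ c → ∑ x ∈ Finset.Ico (l j) (r j), q x ≤ v j →
      P (l j) + v j = P (r j) ∧ φ (r j) ≤ φ (l j) := by
    intro j hj hj' h
    rw [(hsum j hj hj').2, ← ENNReal.ofReal_coe_nnreal,
      ENNReal.ofReal_le_ofReal_iff (v j).coe_nonneg] at h
    have ht : P (l j) + v j = P (r j) := by
      by_contra hne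
      have := h2 j hne
      linarith
    refine ⟨ht, ?_⟩
    by_contra! hlt
    have := mul_pos hε (sub_pos.2 hlt)
    linarith
  refine ⟨q, Finset.Ico a c, subset_rfl, (sum_Ico_sub_eq P hac).ge,
    fun j hj hj' h => (hle j hj hj' h).1, ?_⟩
  intro x hx
  rw [Finset.mem_Ico] at hx
  obtain ⟨j, j1, j2, j3, j4, j5, j6⟩ := hcover x hx.1 hx.2
  refine ⟨j, j1, j2, j3, ?_, fun k k1 k2 k3 k4 =>
    j6 k k1 k2 (hle k k1 k2 k3).1 (hle k k1 k2 k3).2 k4⟩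
  have := mul_pos hε (sub_pos.2 j5)
  rw [(hsum j j1 j2).2, ← ENNReal.ofReal_coe_nnreal]
  by_cases hv : 0 < (v j : ℝ)
  · rw [ENNReal.ofReal_lt_ofReal_iff hv]
    linarith
  · have h0 := (hsum j j1 j2).1
    have := (v j).coe_nonneg
    linarith

theorem TightArc.exists_eq {x y : ℕ} (h : TightArc l r v P x y) (hP : P x < P y) :
    ∃ j, l j = x ∧ r j = y ∧ P x + v j = P y := by
  rcases h.2 with h | h
  · exact h
  · exact absurd h.2 hP.ne

theorem secures_single (hP : Monotone P) (hub : ∀ j, P (l j) + v j ≤ P (r j))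
    (hlr : ∀ j, l j < r j) {d : ℕ → ℕ} (hd : ∀ x y, TightArc l r v P x y → d x + 1 ≤ d y)
    {a c : ℕ} (hT : TightArc l r v P a c) (hac : d c = d a + 1) :
    Secures l r v P a c (P c - P a) := by
  rcases (hP hT.1.le).eq_or_lt with h0 | h0
  · rw [← h0, sub_self]
    exact secures_zero hlr a c
  set φ : ℕ → ℝ := fun x => x + if x = a ∨ (x ≠ c ∧ d a < d x) then (c + 1 : ℝ) else 0 with hφ
  have key : ∀ x y, a ≤ x → y ≤ c → TightArc l r v P x y → φ y ≤ φ x → x = a ∧ y = c := by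
    intro x y hx hy hxy hle
    by_contra hne
    have h1 := hd x y hxy
    have h2 : (x : ℝ) < y := by exact_mod_cast hxy.1
    have h3 := hxy.1
    by_cases hx' : x = a ∨ (x ≠ c ∧ d a < d x)
    · have hy' : y = a ∨ (y ≠ c ∧ d a < d y) := by
        right
        rcases hx' with rfl | hx'
        · exact ⟨fun h => hne ⟨rfl, h⟩, by omega⟩
        · exact ⟨by rintro rfl; omega, by omega⟩
      simp only [hφ, if_pos hx', if_pos hy'] at hle
      linarith
    · simp only [hφ, if_neg hx'] at hle
      split_ifs at hle <;> linarith [(Nat.cast_nonneg c : (0 : ℝ) ≤ c)]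
  obtain ⟨j, rfl, rfl, hj⟩ := hT.exists_eq h0
  have hneg : φ (r j) < φ (l j) := by
    have h1 : ¬ (r j = l j ∨ (r j ≠ r j ∧ d (l j) < d (r j))) := by
      have := hlr j
      simp; omega
    simp only [hφ, if_neg h1, true_or, if_true]
    linarith [(Nat.cast_nonneg (l j) : (0 : ℝ) ≤ l j)]
  refine secures_of_tilt hP hub hlr (hlr j).le φ ?_ ?_
  · intro x hx hx' hflat
    by_contra! hlt
    obtain ⟨h1, h2⟩ := key x (x + 1) hx hx' ⟨by omega, Or.inr ⟨rfl, hflat⟩⟩ hlt.le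
    rw [h1, ← h1, h2, h1] at hflat
    exact h0.ne hflat
  · intro x hx hx'
    refine ⟨j, le_rfl, le_rfl, Finset.mem_Ico.2 ⟨hx, hx'⟩, hj, hneg, ?_⟩
    intro k k1 k2 k3 k4 _
    obtain ⟨h1, h2⟩ := key _ _ k1 k2 ⟨hlr k, Or.inl ⟨k, rfl, rfl, k3⟩⟩ k4
    rw [h1, h2]

theorem secures_pair (hP : Monotone P) (hub : ∀ j, P (l j) + v j ≤ P (r j))
    (hlr : ∀ j, l j < r j) {d : ℕ → ℕ} (hd : ∀ x y, TightArc l r v P x y → d x + 1 ≤ d y)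
    {a b c : ℕ} (hab : TightArc l r v P a b) (hbc : TightArc l r v P b c)
    (hdb : d b = d a + 1) (hdc : d c = d b + 1)
    (huniq : ∀ y, TightArc l r v P a y → TightArc l r v P y c → y = b) :
    Secures l r v P a c (P c - P a) := by
  rcases (hP hab.1.le).eq_or_lt with h0 | h0
  · have := (secures_zero (v := v) (P := P) hlr a a).append hlr le_rfl hbc.1.le hab.1
      (secures_single hP hub hlr hd hbc hdc)
    rwa [zero_add, ← h0] at this
  rcases (hP hbc.1.le).eq_or_lt with h0' | h0'
  · have := (secures_single hP hub hlr hd hab hdb).append hlr hab.1.le le_rfl hbc.1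
      (secures_zero (v := v) (P := P) hlr c c)
    rwa [add_zero, h0'] at this
  set R₁ : ℕ → Prop := fun x =>
    x = a ∨ (TightArc l r v P a x ∧ x ≠ b ∧ x ≠ c) ∨ (x ≠ c ∧ d a + 2 ≤ d x) with hR₁
  set R₂ : ℕ → Prop := fun x => x = b ∨ R₁ x with hR₂
  set φ : ℕ → ℝ := fun x => x + (if R₁ x then (c + 1 : ℝ) else 0) +
    (if R₂ x then (c + 1 : ℝ) else 0) with hφ
  have hc0 : (0 : ℝ) ≤ c := Nat.cast_nonneg c
  have key : ∀ x y, a ≤ x → y ≤ c → TightArc l r v P x y → φ y ≤ φ x →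
      (x = a ∧ y = b) ∨ (x = b ∧ y = c) ∨ (x = a ∧ y = c) := by
    intro x y hx hy hxy hle
    by_contra! hne
    obtain ⟨hne1, hne2, hne3⟩ := hne
    have h1 := hd x y hxy
    have h2 : (x : ℝ) < y := by exact_mod_cast hxy.1
    have h3 := hxy.1
    have c₁ : R₁ x → R₁ y := by
      rintro (rfl | ⟨hx1, hx2, hx3⟩ | ⟨hx1, hx2⟩)
      · exact Or.inr (Or.inl ⟨hxy, hne1 rfl, hne3 rfl⟩)
      · have := hd _ _ hx1
        exact Or.inr (Or.inr ⟨by rintro rfl; exact hx2 (huniq x hx1 hxy), by omega⟩)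
      · exact Or.inr (Or.inr ⟨by rintro rfl; omega, by omega⟩)
    have c₂ : R₂ x → R₂ y := by
      rintro (rfl | hx1)
      · exact Or.inr (Or.inr (Or.inr ⟨hne2 rfl, by omega⟩))
      · exact Or.inr (c₁ hx1)
    have e₁ : (if R₁ x then (c + 1 : ℝ) else 0) ≤ if R₁ y then (c + 1 : ℝ) else 0 := by
      split_ifs with i1 i2 <;> first | exact absurd (c₁ i1) i2 | linarith
    have e₂ : (if R₂ x then (c + 1 : ℝ) else 0) ≤ if R₂ y then (c + 1 : ℝ) else 0 := by
      split_ifs with i1 i2 <;> first | exact absurd (c₂ i1) i2 | linarith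
    simp only [hφ] at hle
    linarith
  have hlab := hab.1
  have hlbc := hbc.1
  have a₁ : R₁ a := Or.inl rfl
  have a₂ : R₂ a := Or.inr a₁
  have b₁ : ¬ R₁ b := by
    rintro (h | ⟨_, h, _⟩ | ⟨_, h⟩)
    · omega
    · exact h rfl
    · omega
  have b₂ : R₂ b := Or.inl rfl
  have c₁ : ¬ R₁ c := by
    rintro (h | ⟨_, _, h⟩ | ⟨h, _⟩)
    · omega
    · exact h rfl
    · exact h rfl
  have c₂ : ¬ R₂ c := by
    rintro (h | h)
    · omega
    · exact c₁ h
  have ra : (0 : ℝ) ≤ a := Nat.cast_nonneg a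
  have rb : (b : ℝ) < c := by exact_mod_cast hlbc
  have ra' : (0 : ℝ) ≤ b := Nat.cast_nonneg b
  have hφa : φ a = a + (c + 1) + (c + 1) := by simp only [hφ, if_pos a₁, if_pos a₂]
  have hφb : φ b = b + 0 + (c + 1) := by simp only [hφ, if_neg b₁, if_pos b₂]
  have hφc : φ c = c + 0 + 0 := by simp only [hφ, if_neg c₁, if_neg c₂]
  obtain ⟨j, jl, jr, hj⟩ := hab.exists_eq h0
  obtain ⟨j', jl', jr', hj'⟩ := hbc.exists_eq h0'
  refine secures_of_tilt hP hub hlr (hlab.le.trans hlbc.le) φ ?_ ?_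
  · intro x hx hx' hflat
    by_contra! hlt
    have hne : ∀ y z : ℕ, P y < P z → x = y → x + 1 = z → False := by
      rintro y z h rfl rfl
      exact h.ne hflat
    rcases key x (x + 1) hx hx' ⟨by omega, Or.inr ⟨rfl, hflat⟩⟩ hlt.le with h | h | h
    · exact hne _ _ h0 h.1 h.2
    · exact hne _ _ h0' h.1 h.2
    · exact hne _ _ (h0.trans h0') h.1 h.2
  · have harc : ∀ k, a ≤ l k → r k ≤ c → P (l k) + v k = P (r k) → φ (r k) ≤ φ (l k) →
        (l k = a ∧ r k = b) ∨ (l k = b ∧ r k = c) ∨ (l k = a ∧ r k = c) :=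
      fun k k1 k2 k3 k4 => key _ _ k1 k2 ⟨hlr k, Or.inl ⟨k, rfl, rfl, k3⟩⟩ k4
    intro x hx hx'
    rcases Nat.lt_or_ge x b with hxb | hxb
    · refine ⟨j, jl.ge, by omega, Finset.mem_Ico.2 ⟨by omega, by omega⟩, by rw [jl, jr, hj],
        by rw [jl, jr]; linarith, ?_⟩
      intro k k1 k2 k3 k4 k5
      rcases harc k k1 k2 k3 k4 with h | h | h
      · rw [jl, jr, h.1, h.2]
      · refine absurd ?_ k5
        rw [jl, jr, h.1, h.2]
        exact Finset.Ico_disjoint_Ico_consecutive a b c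
      · rw [jl, jr, h.1, h.2]
        exact Finset.Ico_subset_Ico_right hlbc.le
    · refine ⟨j', by omega, by omega, Finset.mem_Ico.2 ⟨by omega, by omega⟩, by rw [jl', jr', hj'],
        by rw [jl', jr']; linarith, ?_⟩
      intro k k1 k2 k3 k4 k5
      rcases harc k k1 k2 k3 k4 with h | h | h
      · refine absurd ?_ k5
        rw [jl', jr', h.1, h.2]
        exact (Finset.Ico_disjoint_Ico_consecutive a b c).symm
      · rw [jl', jr', h.1, h.2]
      · rw [jl', jr', h.1, h.2]
        exact Finset.Ico_subset_Ico_left hlab.le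

/-- Within a chain of maximal length, three pricings together secure the whole potential
twice. -/
theorem exists_secures (hP : Monotone P) (hP0 : P 0 = 0) (hub : ∀ j, P (l j) + v j ≤ P (r j))
    (hlr : ∀ j, l j < r j) (hpred : ∀ y, 0 < y → ∃ x, TightArc l r v P x y) (m : ℕ) :
    ∃ w, 2 / 3 * P m ≤ w ∧ Secures l r v P 0 m w := by
  set T := TightArc l r v P with hTdef
  have hd : ∀ x y, T x y → depth T x + 1 ≤ depth T y := fun x y h => depth_lt_depth h.1 h
  obtain ⟨s, hs0, hsk, hsd, hs⟩ := exists_leftmost_chain (T := T) (fun x y h => h.1) hpred m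
  set k := depth T m with hk
  set d := depth T with hddef
  -- `u i` is a vertex through which the chain can be rerouted, different from `s i` if possible
  have hu : ∃ u : ℕ → ℕ, u 0 = 0 ∧ u k = s k ∧ (∀ i ≤ k, s i ≤ u i ∧ d (u i) = i) ∧
      (∀ i < k, T (u i) (s (i + 1)) ∧ T (s i) (u (i + 1))) ∧
      ∀ i, i + 1 < k → u (i + 1) = s (i + 1) →
        ∀ y, T (s i) y → T y (s (i + 2)) → y = s (i + 1) := by
    have hex : ∀ i, ∃ y, (0 < i ∧ i < k → T (s (i - 1)) y ∧ T y (s (i + 1)) ∧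
        (y = s i → ∀ z, T (s (i - 1)) z → T z (s (i + 1)) → z = s i)) ∧
        (¬ (0 < i ∧ i < k) → y = s i) := by
      intro i
      by_cases hi : 0 < i ∧ i < k
      · by_cases hz : ∃ z, T (s (i - 1)) z ∧ T z (s (i + 1)) ∧ z ≠ s i
        · obtain ⟨z, h1, h2, h3⟩ := hz
          exact ⟨z, fun _ => ⟨h1, h2, fun h => absurd h h3⟩, fun h => absurd hi h⟩
        · push Not at hz
          refine ⟨s i, fun _ => ⟨?_, (hs i hi.2).1, fun _ => hz⟩, fun _ => rfl⟩
          have := (hs (i - 1) (by omega)).1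
          rwa [Nat.sub_add_cancel hi.1] at this
      · exact ⟨s i, fun h => absurd h hi, fun _ => rfl⟩
    choose u hu hu' using hex
    refine ⟨u, ?_, hu' k (by omega), ?_, ?_, ?_⟩
    · rw [hu' 0 (by omega), hs0]
    · intro i hi
      by_cases h : 0 < i ∧ i < k
      · obtain ⟨h1, h2, -⟩ := hu i h
        have e1 := hd _ _ h1
        have e2 := hd _ _ h2
        have e3 := hsd (i - 1) (by omega)
        have e4 := hsd (i + 1) (by omega)
        have e5 : d (u i) = i := by omega
        exact ⟨(hs i h.2).2 _ h2 e5, e5⟩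
      · rw [hu' i h]
        exact ⟨le_rfl, hsd i hi⟩
    · intro i hi
      constructor
      · by_cases h : 0 < i ∧ i < k
        · exact (hu i h).2.1
        · rw [hu' i h]; exact (hs i hi).1
      · by_cases h : 0 < i + 1 ∧ i + 1 < k
        · exact (hu _ h).1
        · rw [hu' _ h]; exact (hs i hi).1
    · intro i hi h
      exact (hu (i + 1) ⟨by omega, hi⟩).2.2 h
  obtain ⟨u, hu0, huk, hud, huT, huniq⟩ := hu
  have hinv : ∀ i ≤ k, ∃ wA wB wC : ℝ, wA + wB + wC = P (s i) + P (u i) ∧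
      (∀ c w, s i ≤ c → Secures l r v P (s i) c w → Secures l r v P 0 c (wA + w)) ∧
      (i < k → Secures l r v P 0 (s (i + 1)) (wB + (P (s (i + 1)) - P (u i)))) ∧
      (i = k → Secures l r v P 0 (s i) wB) ∧
      Secures l r v P 0 (u i) wC := by
    have hY : ∀ i < k, Secures l r v P (u i) (s (i + 1)) (P (s (i + 1)) - P (u i)) := by
      intro i hi
      exact secures_single hP hub hlr hd (huT i hi).1 (by rw [hsd _ hi, (hud i hi.le).2])
    have hX : ∀ i < k, Secures l r v P (s i) (u (i + 1)) (P (u (i + 1)) - P (s i)) := by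
      intro i hi
      exact secures_single hP hub hlr hd (huT i hi).2 (by rw [hsd _ hi.le, (hud _ hi).2])
    intro i
    induction i with
    | zero =>
      intro _
      refine ⟨0, 0, 0, by rw [hs0, hu0, hP0]; ring, ?_, ?_, ?_, secures_zero hlr _ _⟩
      · intro c w _ h
        rwa [hs0, ← zero_add w] at h
      · intro h
        have := hY 0 h
        simpa [hu0] using this
      · intro _; exact secures_zero hlr _ _
    | succ i ih =>
      intro hi
      obtain ⟨wA, wB, wC, hsum, hA, hB, -, hC⟩ := ih (by omega)
      have hi' : i < k := hi
      have hB := hB hi'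
      have hA' := hA _ _ (huT i hi').2.1.le (hX i hi')
      have hC' : ∀ c w, s (i + 1) ≤ c → Secures l r v P (s (i + 1)) c w →
          Secures l r v P 0 c (wC + w) := fun c w hc h =>
        hC.append hlr (Nat.zero_le _) hc (huT i hi').1.1 h
      by_cases hbad : u (i + 1) = s (i + 1)
      · refine ⟨wC, wA + (P (u (i + 1)) - P (s i)), wB + (P (s (i + 1)) - P (u i)), ?_, hC', ?_,
          ?_, ?_⟩
        · rw [hbad]; linarith
        · intro h
          have hpair := secures_pair hP hub hlr hd (hs i hi').1 (hs (i + 1) h).1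
            (by rw [hsd _ hi'.le, hsd _ hi]) (by rw [hsd _ hi, hsd _ h]) (huniq i h hbad)
          have := hA _ _ ((hs i hi').1.1.le.trans (hs (i + 1) h).1.1.le) hpair
          convert this using 1
          ring
        · intro _; rw [← hbad]; exact hA'
        · rw [hbad]; exact hB
      · have hlt : s (i + 1) < u (i + 1) := lt_of_le_of_ne (hud _ hi).1 (Ne.symm hbad)
        refine ⟨wC, wB + (P (s (i + 1)) - P (u i)), wA + (P (u (i + 1)) - P (s i)), by linarith,
          hC', ?_, ?_, hA'⟩
        · intro h
          exact hB.append hlr (Nat.zero_le _) (huT _ h).1.1.le hlt (hY _ h)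
        · intro h
          exact absurd (by rw [h]; exact huk) hbad
  obtain ⟨wA, wB, wC, hsum, hA, -, hB, hC⟩ := hinv k le_rfl
  have hA := hA _ _ le_rfl (secures_zero hlr _ _)
  have hB := hB rfl
  rw [huk] at hC hsum
  rw [hsk] at hA hB hC hsum
  by_cases h1 : 2 / 3 * P m ≤ wA
  · exact ⟨_, by linarith, hA⟩
  by_cases h2 : 2 / 3 * P m ≤ wB
  · exact ⟨_, h2, hB⟩
  exact ⟨_, by linarith, hC⟩

end Line

section Sale

variable {V : Type*} [DecidableEq V] {n : ℕ} (p : Sym2 V → ℝ≥0∞)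
  (Q : Fin n → Finset (Sym2 V)) (v : Fin n → ℝ≥0) (t : Fin n → Bool)

theorem foldl_step_spec (E : Finset (Sym2 V)) (hQ : ∀ j, (Q j).Nonempty) (hE : ∀ j, Q j ⊆ E)
    (L : List (Fin n)) :
    ∃ A B, L.foldl (step p Q v t) (E, ∅) = (A, B) ∧
      (∀ j ∈ B, price p (Q j) ≤ v j) ∧
      (B : Set (Fin n)).Pairwise (fun j k => Disjoint (Q j) (Q k)) ∧
      (∀ e, e ∈ A ↔ e ∈ E ∧ ∀ j ∈ B, e ∉ Q j) ∧
      ∀ j ∈ L, price p (Q j) < v j → ∃ k ∈ B, ¬ Disjoint (Q j) (Q k) := by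
  induction L using List.reverseRecOn with
  | nil => exact ⟨E, ∅, rfl, by simp, by simp, by simp, by simp⟩
  | append_singleton L i ih =>
    obtain ⟨A, B, hAB, h1, h2, h3, h4⟩ := ih
    rw [List.foldl_append, hAB]
    simp only [List.foldl_cons, List.foldl_nil, step]
    split_ifs with hi
    · refine ⟨_, _, rfl, ?_, ?_, ?_, ?_⟩
      · intro j hj
        rcases Finset.mem_insert.1 hj with rfl | hj
        · exact hi.2.elim le_of_lt fun h => h.1.le
        · exact h1 j hj
      · rw [Finset.coe_insert]
        have hdisj : ∀ k ∈ B, Disjoint (Q i) (Q k) := fun k hk =>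
          Finset.disjoint_left.2 fun e he => ((h3 e).1 (hi.1 he)).2 k hk
        exact h2.insert fun k hk _ => ⟨hdisj k hk, (hdisj k hk).symm⟩
      · intro e
        rw [Finset.mem_sdiff, h3]
        simp only [Finset.mem_insert, forall_eq_or_imp]
        tauto
      · intro j hj hlt
        rcases List.mem_append.1 hj with hj | hj
        · obtain ⟨k, hk, hk'⟩ := h4 j hj hlt
          exact ⟨k, Finset.mem_insert_of_mem hk, hk'⟩
        · rw [List.mem_singleton] at hj
          subst hj
          refine ⟨j, Finset.mem_insert_self _ _, ?_⟩
          rw [disjoint_self]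
          exact (hQ j).ne_empty
    · refine ⟨A, B, rfl, h1, h2, h3, ?_⟩
      intro j hj hlt
      rcases List.mem_append.1 hj with hj | hj
      · exact h4 j hj hlt
      · rw [List.mem_singleton] at hj
        subst hj
        have hnot : ¬ Q j ⊆ A := fun h => hi ⟨h, Or.inl hlt⟩
        rw [Finset.not_subset] at hnot
        obtain ⟨e, he, heA⟩ := hnot
        rw [h3] at heA
        push Not at heA
        obtain ⟨k, hk, hek⟩ := heA (hE j he)
        exact ⟨k, hk, Finset.not_disjoint_iff.2 ⟨e, he, hek⟩⟩

theorem purchased_spec [Fintype V] (G : SimpleGraph V) (hQ : ∀ j, (Q j).Nonempty)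
    (hE : ∀ j, Q j ⊆ G.edgeFinset) (σ : Equiv.Perm (Fin n)) :
    (∀ j ∈ purchased G p Q v σ t, price p (Q j) ≤ v j) ∧
      (purchased G p Q v σ t : Set (Fin n)).Pairwise (fun j k => Disjoint (Q j) (Q k)) ∧
      ∀ j, price p (Q j) < v j → ∃ k ∈ purchased G p Q v σ t, ¬ Disjoint (Q j) (Q k) := by
  obtain ⟨A, B, hAB, h1, h2, -, h4⟩ :=
    foldl_step_spec p Q v t G.edgeFinset hQ hE (List.ofFn fun i => σ i)
  have hB : purchased G p Q v σ t = B := by rw [purchased, hAB]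
  rw [hB]
  exact ⟨h1, h2, fun j => h4 j (by rw [List.mem_ofFn]; exact ⟨σ.symm j, by simp⟩)⟩

end Sale

section PathGraph

variable {V : Type*} [Fintype V] [DecidableEq V] {G : SimpleGraph V}

/-- A path graph embeds in the line so that adjacent vertices are at distance one. -/
theorem IsPathGraph.exists_coordinate (hG : IsPathGraph G) :
    ∃ f : V → ℕ, Function.Injective f ∧ ∀ a b, G.Adj a b → f a = f b + 1 ∨ f b = f a + 1 := by
  obtain ⟨htree, hdeg⟩ := hG
  rcases subsingleton_or_nontrivial V with hV | hV
  · exact ⟨fun _ => 0, fun a b _ => Subsingleton.elim a b,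
      fun a b h => absurd (Subsingleton.elim a b) h.ne⟩
  obtain ⟨o, ho⟩ := htree.exists_vert_degree_one_of_nontrivial
  have hconn := htree.1
  have hback : ∀ k x, G.dist o x = k + 1 → ∃ y, G.Adj x y ∧ G.dist o y = k := by
    intro k x hx
    obtain ⟨W, hW⟩ := hconn.exists_walk_length_eq_dist x o
    rw [SimpleGraph.dist_comm, hx] at hW
    cases W with
    | nil => simp at hW
    | @cons _ y _ h W =>
      refine ⟨y, h, ?_⟩
      rw [SimpleGraph.Walk.length_cons] at hW
      have h1 := SimpleGraph.dist_le W
      have h2 : G.dist o x ≤ G.dist o y + G.dist y x := hconn.dist_triangle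
      have h3 : G.dist y x = 1 := SimpleGraph.dist_eq_one_iff_adj.2 h.symm
      rw [SimpleGraph.dist_comm] at h1
      omega
  have hinj : ∀ k x y, G.dist o x = k → G.dist o y = k → x = y := by
    intro k
    induction k with
    | zero =>
      intro x y hx hy
      rw [hconn.dist_eq_zero_iff] at hx hy
      rw [← hx, hy]
    | succ k ih =>
      intro x y hx hy
      obtain ⟨a, hxa, ha⟩ := hback k x hx
      obtain ⟨b, hyb, hb⟩ := hback k y hy
      obtain rfl := ih a b ha hb
      by_contra hxy
      rcases k with _ | k
      · rw [hconn.dist_eq_zero_iff] at ha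
        subst ha
        have : ({x, y} : Finset V) ⊆ G.neighborFinset o := by
          intro z hz
          rw [SimpleGraph.mem_neighborFinset]
          simp only [Finset.mem_insert, Finset.mem_singleton] at hz
          rcases hz with rfl | rfl
          · exact hxa.symm
          · exact hyb.symm
        have h2 := Finset.card_le_card this
        rw [Finset.card_pair hxy, SimpleGraph.card_neighborFinset_eq_degree] at h2
        omega
      · obtain ⟨c, hac, hc⟩ := hback k a ha
        have : ({x, y, c} : Finset V) ⊆ G.neighborFinset a := by
          intro z hz
          rw [SimpleGraph.mem_neighborFinset]
          simp only [Finset.mem_insert, Finset.mem_singleton] at hz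
          rcases hz with rfl | rfl | rfl
          · exact hxa.symm
          · exact hyb.symm
          · exact hac
        have hxc : x ≠ c := by rintro rfl; omega
        have hyc : y ≠ c := by rintro rfl; omega
        have h2 := Finset.card_le_card this
        rw [SimpleGraph.card_neighborFinset_eq_degree,
          Finset.card_eq_three.2 ⟨x, y, c, hxy, hxc, hyc, rfl⟩] at h2
        have := hdeg a
        omega
  refine ⟨G.dist o, fun x y h => hinj _ x y h rfl, ?_⟩
  intro a b hab
  have h1 : G.dist o a ≤ G.dist o b + G.dist b a := hconn.dist_triangle
  have h2 : G.dist o b ≤ G.dist o a + G.dist a b := hconn.dist_triangle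
  rw [SimpleGraph.dist_eq_one_iff_adj.2 hab] at h2
  rw [SimpleGraph.dist_eq_one_iff_adj.2 hab.symm] at h1
  have h3 : G.dist o a ≠ G.dist o b := fun h => hab.ne (hinj _ a b h rfl)
  omega

end PathGraph

section EdgePosition

variable {V : Type*}

/-- The position of an edge, the smaller of the coordinates of its endpoints. -/
def edgePosition (f : V → ℕ) : Sym2 V → ℕ :=
  Sym2.lift ⟨fun a b => min (f a) (f b), fun _ _ => min_comm _ _⟩

theorem edgePosition_mk (f : V → ℕ) (a b : V) : edgePosition f s(a, b) = min (f a) (f b) := rfl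

variable {G : SimpleGraph V} {f : V → ℕ}

theorem edgePosition_injOn (hf : Function.Injective f)
    (hadj : ∀ a b, G.Adj a b → f a = f b + 1 ∨ f b = f a + 1) :
    Set.InjOn (edgePosition f) G.edgeSet := by
  intro e he e' he' h
  induction e using Sym2.ind with | _ a b =>
  induction e' using Sym2.ind with | _ c d =>
  rw [SimpleGraph.mem_edgeSet] at he he'
  rw [edgePosition_mk, edgePosition_mk] at h
  have h1 := hadj a b he
  have h2 := hadj c d he'
  rw [Sym2.eq_iff, ← hf.eq_iff, ← hf.eq_iff (a := b), ← hf.eq_iff (a := a) (b := d),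
    ← hf.eq_iff (a := b) (b := c)]
  omega

theorem mem_support_of_edgePosition (hf : Function.Injective f)
    (hadj : ∀ a b, G.Adj a b → f a = f b + 1 ∨ f b = f a + 1) {a b x : V} (W : G.Walk a b)
    {e : Sym2 V} (he : e ∈ W.edges) (hx : f x = edgePosition f e ∨ f x = edgePosition f e + 1) :
    x ∈ W.support := by
  induction e using Sym2.ind with | _ c d =>
  have h1 := hadj c d (W.adj_of_mem_edges he)
  rw [edgePosition_mk] at hx
  have : f x = f c ∨ f x = f d := by omega
  rcases this with h | h
  · rw [hf h]; exact W.fst_mem_support_of_mem_edges he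
  · rw [hf h]; exact W.snd_mem_support_of_mem_edges he

theorem image_edgePosition_walk (hf : Function.Injective f)
    (hadj : ∀ a b, G.Adj a b → f a = f b + 1 ∨ f b = f a + 1) [DecidableEq V] {a b : V}
    (W : G.Walk a b) (hW : W.IsPath) :
    W.edges.toFinset.image (edgePosition f) =
      Finset.Ico (min (f a) (f b)) (max (f a) (f b)) := by
  induction W with
  | nil => simp
  | @cons a c b h W ih =>
    rw [SimpleGraph.Walk.cons_isPath_iff] at hW
    have ih := ih hW.1
    rw [SimpleGraph.Walk.edges_cons, List.toFinset_cons, Finset.image_insert, ih,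
      edgePosition_mk]
    have hno : ∀ x ∈ Finset.Ico (min (f c) (f b)) (max (f c) (f b)), f a ≠ x ∧ f a ≠ x + 1 := by
      intro x hx
      rw [← ih, Finset.mem_image] at hx
      obtain ⟨e, he, rfl⟩ := hx
      rw [List.mem_toFinset] at he
      constructor <;> intro hax <;> refine hW.2 (mem_support_of_edgePosition hf hadj W he ?_)
      · exact Or.inl hax
      · exact Or.inr hax
    have h1 := hadj a c h
    have h2 := hno (f a)
    have h3 := hno (f a - 1)
    rw [Finset.mem_Ico] at h2 h3
    ext x
    rw [Finset.mem_insert, Finset.mem_Ico, Finset.mem_Ico]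
    omega

end EdgePosition

/-- The edges of a path graph can be numbered so that demand paths become intervals. -/
theorem IsPathGraph.exists_intervals {V : Type*} [Fintype V] [DecidableEq V] {G : SimpleGraph V}
    (hG : IsPathGraph G) {n : ℕ} {Q : Fin n → Finset (Sym2 V)}
    (hQ : ∀ j, IsPathEdges G (Q j)) :
    ∃ (pos : Sym2 V → ℕ) (l r : Fin n → ℕ), Set.InjOn pos G.edgeSet ∧
      (∀ j, Q j ⊆ G.edgeFinset) ∧ (∀ j, l j < r j) ∧
      ∀ j, (Q j).image pos = Finset.Ico (l j) (r j) := by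
  obtain ⟨f, hf, hadj⟩ := hG.exists_coordinate
  choose a b W hW hne hQW using hQ
  have him : ∀ j, (Q j).image (edgePosition f) =
      Finset.Ico (min (f (a j)) (f (b j))) (max (f (a j)) (f (b j))) := by
    intro j
    rw [hQW j]
    exact image_edgePosition_walk hf hadj (W j) (hW j)
  refine ⟨edgePosition f, _, _, edgePosition_injOn hf hadj, ?_, ?_, him⟩
  · intro j e he
    rw [hQW j, List.mem_toFinset] at he
    rw [SimpleGraph.mem_edgeFinset]
    exact (W j).edges_subset_edgeSet he
  · intro j
    rw [← Finset.nonempty_Ico, ← him j, Finset.image_nonempty, hQW j,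
      List.toFinset_nonempty_iff]
    exact hne j

end Tollbooth

/-- For every tollbooth instance on a path graph, there exists an item
pricing `p` such that for every arrival order `σ` and every tie-breaking choice `t`,
`Wel(p,σ,t) ≥ (2/3)·OPT` (no tie-breaking power needed by the seller). -/
theorem path_no_tie_gap_le_three_halves {V : Type*} [Fintype V] [DecidableEq V]
    (G : SimpleGraph V) (hG : Tollbooth.IsPathGraph G)
    {n : ℕ} (Q : Fin n → Finset (Sym2 V)) (v : Fin n → ℝ≥0)
    (hI : Tollbooth.Instance G Q v) :
    ∃ p : Sym2 V → ℝ≥0∞, ∀ (σ : Equiv.Perm (Fin n)) (t : Fin n → Bool),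
      (2 / 3 : ℝ≥0) * Tollbooth.OPT Q v ≤ Tollbooth.Wel G p Q v σ t := by
  obtain ⟨pos, l, r, hinj, hE, hlr, him⟩ := hG.exists_intervals fun j => (hI.2 j).2
  obtain ⟨P, hP0, hP, hub, hpred⟩ := Tollbooth.exists_potential l r v hlr
  set m := Finset.univ.sup r with hm
  have hrm : ∀ j, r j ≤ m := fun j => Finset.le_sup (Finset.mem_univ j)
  obtain ⟨w, hw, q, K, hK, hwK, hq, hs⟩ := Tollbooth.exists_secures hP hP0 hub hlr hpred m
  have hinjQ : ∀ j, Set.InjOn pos (Q j) := fun j => hinj.mono fun e he => by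
    have := hE j he
    rwa [SimpleGraph.mem_edgeFinset] at this
  have hprice : ∀ j, Tollbooth.price (fun e => q (pos e)) (Q j) =
      ∑ x ∈ Finset.Ico (l j) (r j), q x := by
    intro j
    rw [Tollbooth.price, ← him j, Finset.sum_image (hinjQ j)]
  have hdisj : ∀ j k, Disjoint (Q j) (Q k) ↔
      Disjoint (Finset.Ico (l j) (r j)) (Finset.Ico (l k) (r k)) := by
    intro j k
    rw [← him j, ← him k, Finset.disjoint_left, Finset.disjoint_left]
    constructor
    · intro h x hx hx'
      rw [Finset.mem_image] at hx hx'
      obtain ⟨e, he, rfl⟩ := hx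
      obtain ⟨e', he', hee⟩ := hx'
      have h1 := hE j he
      have h2 := hE k he'
      rw [SimpleGraph.mem_edgeFinset] at h1 h2
      rw [hinj h2 h1 hee] at he'
      exact h he he'
    · intro h e he he'
      exact h (Finset.mem_image_of_mem _ he) (Finset.mem_image_of_mem _ he')
  have hincr : ∀ x, 0 ≤ P (x + 1) - P x := fun x => sub_nonneg.2 (hP (Nat.le_succ x))
  have hunion : ∀ S : Finset (Fin n),
      (S : Set (Fin n)).Pairwise (fun j k => Disjoint (Q j) (Q k)) →
      ∑ j ∈ S, (P (r j) - P (l j)) =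
        ∑ x ∈ S.biUnion fun j => Finset.Ico (l j) (r j), (P (x + 1) - P x) := by
    intro S hS
    rw [Finset.sum_biUnion fun j hj k hk hjk => (hdisj j k).1 (hS hj hk hjk)]
    exact Finset.sum_congr rfl fun j _ => (Tollbooth.sum_Ico_sub_eq P (hlr j).le).symm
  have hopt : (Tollbooth.OPT Q v : ℝ) ≤ P m := by
    have hPm : 0 ≤ P m := hP0 ▸ hP (Nat.zero_le m)
    suffices h : Tollbooth.OPT Q v ≤ (P m).toNNReal by
      rwa [← NNReal.coe_le_coe, Real.coe_toNNReal _ hPm] at h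
    refine Finset.sup_le fun S hS => ?_
    rw [Finset.mem_filter] at hS
    rw [← NNReal.coe_le_coe, Real.coe_toNNReal _ hPm, NNReal.coe_sum]
    calc ∑ j ∈ S, (v j : ℝ) ≤ ∑ j ∈ S, (P (r j) - P (l j)) :=
          Finset.sum_le_sum fun j _ => by linarith [hub j]
      _ = _ := hunion S hS.2
      _ ≤ ∑ x ∈ Finset.Ico 0 m, (P (x + 1) - P x) := by
          refine Finset.sum_le_sum_of_subset_of_nonneg ?_ fun x _ _ => hincr x
          intro x hx
          obtain ⟨j, -, hj⟩ := Finset.mem_biUnion.1 hx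
          have := hrm j
          rw [Finset.mem_Ico] at hj ⊢
          omega
      _ = P m := by rw [Tollbooth.sum_Ico_sub_eq P (Nat.zero_le m), hP0, sub_zero]
  refine ⟨fun e => q (pos e), fun σ t => ?_⟩
  have hne : ∀ j, (Q j).Nonempty := fun j => by
    rw [← Finset.image_nonempty (f := pos), him j, Finset.nonempty_Ico]
    exact hlr j
  obtain ⟨h1, h2, h3⟩ := Tollbooth.purchased_spec (fun e => q (pos e)) Q v t G hne hE σ
  rw [Tollbooth.Wel]
  generalize Tollbooth.purchased G (fun e => q (pos e)) Q v σ t = B at h1 h2 h3 ⊢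
  have hsold : K ⊆ B.biUnion fun j => Finset.Ico (l j) (r j) := by
    intro x hx
    obtain ⟨j, -, -, hxj, hj, hjk⟩ := hs x hx
    obtain ⟨k, hk, hk'⟩ := h3 j (by rwa [hprice])
    rw [hdisj] at hk'
    have hk1 := h1 k hk
    rw [hprice] at hk1
    exact Finset.mem_biUnion.2 ⟨k, hk, hjk k (Nat.zero_le _) (hrm k) hk1 hk' hxj⟩
  have hwel : w ≤ ∑ j ∈ B, (v j : ℝ) := by
    calc w ≤ _ := hwK
      _ ≤ _ := Finset.sum_le_sum_of_subset_of_nonneg hsold fun x _ _ => hincr x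
      _ = _ := (hunion B h2).symm
      _ = _ := by
        refine Finset.sum_congr rfl fun j hj => ?_
        have hj1 := h1 j hj
        rw [hprice] at hj1
        linarith [hq j (Nat.zero_le _) (hrm j) hj1]
  rw [← NNReal.coe_le_coe, NNReal.coe_sum]
  push_cast
  linarith
end
end
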